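/- arXiv:math/0012073 — 3 statements merged into one kernel-verified Lean document; each statement's English description precedes it below -/
import Mathlib

section
/- Let H = {H_α}_{α∈π} be a Hopf π-coalgebra over a field k. Then the set {α ∈ π | H_α ≠ 0} is a subgroup of π. -/
open scoped TensorProduct

noncomputable section

/-- Transport of the algebra structure along an equality of group indices. -/
def gcast (k : Type*) [CommSemiring k] {π : Type*} (H : π → Type*)
    [∀ α, Ring (H α)] [∀ α, Algebra k (H α)] {a b : π} (h : a = b) :
    H a ≃ₐ[k] H b := by subst h; exact AlgEquiv.refl

/-- Transport of a module family along an equality of group indices. -/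
def fcast (k : Type*) [CommSemiring k] {π : Type*} (M : π → Type*)
    [∀ α, AddCommGroup (M α)] [∀ α, Module k (M α)] {a b : π} (h : a = b) :
    M a ≃ₗ[k] M b := by subst h; exact LinearEquiv.refl k (M a)

/-- A Hopf `π`-coalgebra (in the sense of Turaev/Virelizier) over a field `k`:
a family of `k`-algebras `H α` with comultiplication `Δ`, counit `ε` and antipode `S`. -/
class HopfGCoalgebra (k : Type*) [Field k] {π : Type*} [Group π]
    (H : π → Type*) [∀ α, Ring (H α)] [∀ α, Algebra k (H α)] where
  Δ : ∀ α β : π, H (α * β) →ₐ[k] H α ⊗[k] H β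
  ε : H (1 : π) →ₐ[k] k
  S : ∀ α : π, H α →ₗ[k] H α⁻¹
  coassoc : ∀ α β γ : π,
    (TensorProduct.assoc k (H α) (H β) (H γ)).toLinearMap ∘ₗ
        (TensorProduct.map (Δ α β).toLinearMap (LinearMap.id : H γ →ₗ[k] H γ)) ∘ₗ
        (Δ (α * β) γ).toLinearMap
      = (TensorProduct.map (LinearMap.id : H α →ₗ[k] H α) (Δ β γ).toLinearMap) ∘ₗ
        (Δ α (β * γ)).toLinearMap ∘ₗ (gcast k H (mul_assoc α β γ)).toLinearMap
  counit_right : ∀ α : π,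
    (TensorProduct.rid k (H α)).toLinearMap ∘ₗ
        (TensorProduct.map (LinearMap.id : H α →ₗ[k] H α) ε.toLinearMap) ∘ₗ
        (Δ α 1).toLinearMap ∘ₗ (gcast k H (mul_one α).symm).toLinearMap = LinearMap.id
  counit_left : ∀ α : π,
    (TensorProduct.lid k (H α)).toLinearMap ∘ₗ
        (TensorProduct.map ε.toLinearMap (LinearMap.id : H α →ₗ[k] H α)) ∘ₗ
        (Δ 1 α).toLinearMap ∘ₗ (gcast k H (one_mul α).symm).toLinearMap = LinearMap.id
  antipode_left : ∀ α : π,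
    (LinearMap.mul' k (H α)) ∘ₗ
        (TensorProduct.map ((gcast k H (inv_inv α)).toLinearMap ∘ₗ S α⁻¹)
          (LinearMap.id : H α →ₗ[k] H α)) ∘ₗ (Δ α⁻¹ α).toLinearMap
      = (Algebra.linearMap k (H α)) ∘ₗ ε.toLinearMap ∘ₗ
        (gcast k H (inv_mul_cancel α)).toLinearMap
  antipode_right : ∀ α : π,
    (LinearMap.mul' k (H α)) ∘ₗ
        (TensorProduct.map (LinearMap.id : H α →ₗ[k] H α)
          ((gcast k H (inv_inv α)).toLinearMap ∘ₗ S α⁻¹)) ∘ₗ (Δ α α⁻¹).toLinearMap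
      = (Algebra.linearMap k (H α)) ∘ₗ ε.toLinearMap ∘ₗ
        (gcast k H (mul_inv_cancel α)).toLinearMap

namespace HopfGCoalgebra

variable (k : Type*) [Field k] {π : Type*} [Group π] (H : π → Type*)
  [∀ α, Ring (H α)] [∀ α, Algebra k (H α)] [HopfGCoalgebra k H]

/-- A left `π`-integral for `H`. -/
def IsLeftIntegral (lam : ∀ α : π, H α →ₗ[k] k) : Prop :=
  ∀ (α β : π) (x : H (α * β)),
    (TensorProduct.rid k (H α))
        (TensorProduct.map (LinearMap.id : H α →ₗ[k] H α) (lam β) (Δ α β x))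
      = lam (α * β) x • (1 : H α)

/-- A right `π`-integral for `H`. -/
def IsRightIntegral (lam : ∀ α : π, H α →ₗ[k] k) : Prop :=
  ∀ (α β : π) (x : H (α * β)),
    (TensorProduct.lid k (H β))
        (TensorProduct.map (lam α) (LinearMap.id : H β →ₗ[k] H β) (Δ α β x))
      = lam (α * β) x • (1 : H β)

/-- A `π`-grouplike element of `H`. -/
def IsGrouplike (g : ∀ α : π, H α) : Prop :=
  (∀ α β : π, Δ α β (g (α * β)) = g α ⊗ₜ[k] g β) ∧ ε (k := k) (H := H) (g 1) = 1

/-- `g` is the distinguished `π`-grouplike element of `H`. -/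
def IsDistinguishedGrouplike (g : ∀ α : π, H α) : Prop :=
  IsGrouplike k H g ∧
    ∀ lam : ∀ α : π, H α →ₗ[k] k, IsRightIntegral k H lam →
      ∀ (α β : π) (x : H (α * β)),
        (TensorProduct.rid k (H α))
            (TensorProduct.map (LinearMap.id : H α →ₗ[k] H α) (lam β) (Δ α β x))
          = lam (α * β) x • g α

/-- `ν` is the distinguished grouplike element of `H₁*`. -/
def IsDistinguishedNu (ν : H (1 : π) →ₐ[k] k) : Prop :=
  ∀ Λ : H (1 : π), (∀ x : H (1 : π), x * Λ = ε (k := k) (H := H) x • Λ) →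
    ∀ x : H (1 : π), Λ * x = ν x • Λ

/-- The right action `a ↼ f` of `f ∈ H₁*` on `a ∈ H α`. -/
def hitR (f : H (1 : π) →ₗ[k] k) {α : π} (a : H α) : H α :=
  (TensorProduct.lid k (H α))
    (TensorProduct.map f (LinearMap.id : H α →ₗ[k] H α)
      (Δ 1 α ((gcast k H (one_mul α).symm) a)))

/-- The left action `f ⇀ a` of `f ∈ H₁*` on `a ∈ H α`. -/
def hitL (f : H (1 : π) →ₗ[k] k) {α : π} (a : H α) : H α :=
  (TensorProduct.rid k (H α))
    (TensorProduct.map (LinearMap.id : H α →ₗ[k] H α) f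
      (Δ α 1 ((gcast k H (mul_one α).symm) a)))


/-- The comultiplication, with all arguments explicit. -/
def comul (α β : π) : H (α * β) →ₐ[k] H α ⊗[k] H β := Δ α β

/-- The counit, with all arguments explicit. -/
def counit : H (1 : π) →ₐ[k] k := ε

/-- The antipode, with all arguments explicit. -/
def antipode (α : π) : H α →ₗ[k] H α⁻¹ := S α

end HopfGCoalgebra

open HopfGCoalgebra
/-- A right Hopf `π`-comodule over `H`. -/
class HopfGComodule (k : Type*) [Field k] {π : Type*} [Group π]
    (H : π → Type*) [∀ α, Ring (H α)] [∀ α, Algebra k (H α)] [HopfGCoalgebra k H]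
    (M : π → Type*) [∀ α, AddCommGroup (M α)] [∀ α, Module k (M α)] where
  ρ : ∀ α β : π, M (α * β) →ₗ[k] M α ⊗[k] H β
  ρ_coassoc : ∀ α β γ : π,
    (TensorProduct.assoc k (M α) (H β) (H γ)).toLinearMap ∘ₗ
        (TensorProduct.map (ρ α β) (LinearMap.id : H γ →ₗ[k] H γ)) ∘ₗ (ρ (α * β) γ)
      = (TensorProduct.map (LinearMap.id : M α →ₗ[k] M α) (Δ β γ).toLinearMap) ∘ₗ
        (ρ α (β * γ)) ∘ₗ (fcast k M (mul_assoc α β γ)).toLinearMap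
  ρ_counit : ∀ α : π,
    (TensorProduct.rid k (M α)).toLinearMap ∘ₗ
        (TensorProduct.map (LinearMap.id : M α →ₗ[k] M α)
          (ε (k := k) (H := H)).toLinearMap) ∘ₗ
        (ρ α 1) ∘ₗ (fcast k M (mul_one α).symm).toLinearMap = LinearMap.id
  act : ∀ α : π, M α →ₗ[k] H α →ₗ[k] M α
  act_one : ∀ (α : π) (m : M α), act α m 1 = m
  act_mul : ∀ (α : π) (m : M α) (a b : H α), act α (act α m a) b = act α m (a * b)
  ρ_act : ∀ (α β : π) (m : M (α * β)) (a : H (α * β)),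
    ρ α β (act (α * β) m a)
      = TensorProduct.map (TensorProduct.lift (act α)) (LinearMap.mul' k (H β))
          ((TensorProduct.tensorTensorTensorComm k (M α) (H β) (H α) (H β))
            (ρ α β m ⊗ₜ[k] (Δ α β a)))

namespace HopfGComodule

variable (k : Type*) [Field k] {π : Type*} [Group π] (H : π → Type*)
  [∀ α, Ring (H α)] [∀ α, Algebra k (H α)] [HopfGCoalgebra k H]
  (M : π → Type*) [∀ α, AddCommGroup (M α)] [∀ α, Module k (M α)] [HopfGComodule k H M]

/-- The submodule of coinvariant families of `H` on `M`. -/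
def coinvFam : Submodule k (∀ α, M α) where
  carrier := {m | ∀ α β : π, ρ (H := H) α β (m (α * β)) = m α ⊗ₜ[k] (1 : H β)}
  add_mem' := by
    intro a b ha hb α β
    simp only [Pi.add_apply, map_add, ha α β, hb α β, TensorProduct.add_tmul]
  zero_mem' := by
    intro α β
    simp only [Pi.zero_apply, map_zero, TensorProduct.zero_tmul]
  smul_mem' := by
    intro c a ha α β
    simp only [Pi.smul_apply, map_smul, ha α β, TensorProduct.smul_tmul']

/-- The `α`-component of the `π`-subcomodule of coinvariants. -/
def coinvSub (α : π) : Submodule k (M α) :=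
  (coinvFam k H M).map (LinearMap.proj α : (∀ γ, M γ) →ₗ[k] M α)

end HopfGComodule

section Cosemisimple

variable (k : Type*) [Field k] {π : Type*} [Group π] (H : π → Type*)
  [∀ α, Ring (H α)] [∀ α, Algebra k (H α)]
  (M : π → Type*) [∀ α, AddCommGroup (M α)] [∀ α, Module k (M α)]

/-- `N` is a `π`-subcomodule of the right `π`-comodule `(M, ρ)` over `H`. -/
def IsGSubcomodule (ρ : ∀ α β : π, M (α * β) →ₗ[k] M α ⊗[k] H β)
    (N : ∀ α, Submodule k (M α)) : Prop :=
  ∀ (α β : π), ∀ x ∈ N (α * β),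
    ρ α β x ∈ LinearMap.range
      (TensorProduct.map (N α).subtype (LinearMap.id : H β →ₗ[k] H β))

/-- `N` is a simple `π`-subcomodule of `(M, ρ)`. -/
def IsSimpleGSubcomodule (ρ : ∀ α β : π, M (α * β) →ₗ[k] M α ⊗[k] H β)
    (N : ∀ α, Submodule k (M α)) : Prop :=
  IsGSubcomodule k H M ρ N ∧ (∃ α, N α ≠ ⊥) ∧
    ∀ P : ∀ α, Submodule k (M α), IsGSubcomodule k H M ρ P → (∀ α, P α ≤ N α) →
      (∀ α, P α = ⊥) ∨ P = N

/-- The right `π`-comodule `(M, ρ)` is cosemisimple: it is the sum of its simple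
`π`-subcomodules. -/
def IsGCosemisimple (ρ : ∀ α β : π, M (α * β) →ₗ[k] M α ⊗[k] H β) : Prop :=
  ∀ α : π,
    (⨆ N : {N : ∀ γ, Submodule k (M γ) // IsSimpleGSubcomodule k H M ρ N}, N.1 α) = ⊤

end Cosemisimple

section CoalgCosemisimple

variable (k : Type*) [Field k] (C : Type*) [AddCommGroup C] [Module k C]

/-- `N` is a subcomodule of the coalgebra `(C, δ)` viewed as a right comodule over itself. -/
def IsSubcoideal (δ : C →ₗ[k] C ⊗[k] C) (N : Submodule k C) : Prop :=
  ∀ x ∈ N, δ x ∈ LinearMap.range (TensorProduct.map N.subtype (LinearMap.id : C →ₗ[k] C))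

def IsSimpleSubcoideal (δ : C →ₗ[k] C ⊗[k] C) (N : Submodule k C) : Prop :=
  IsSubcoideal k C δ N ∧ N ≠ ⊥ ∧
    ∀ P : Submodule k C, IsSubcoideal k C δ P → P ≤ N → P = ⊥ ∨ P = N

/-- The coalgebra `(C, δ)` is cosemisimple. -/
def IsCosemisimpleCoalgebra (δ : C →ₗ[k] C ⊗[k] C) : Prop :=
  (⨆ N : {N : Submodule k C // IsSimpleSubcoideal k C δ N}, N.1) = ⊤

end CoalgCosemisimple
/-- A crossed Hopf `π`-coalgebra: a Hopf `π`-coalgebra with a crossing `φ`. -/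
class CrossedHopfGCoalgebra (k : Type*) [Field k] {π : Type*} [Group π]
    (H : π → Type*) [∀ α, Ring (H α)] [∀ α, Algebra k (H α)]
    extends HopfGCoalgebra k H where
  φ : ∀ β α : π, H α ≃ₐ[k] H (β * α * β⁻¹)
  φ_comul : ∀ β α γ : π,
    (TensorProduct.map (φ β α).toLinearMap (φ β γ).toLinearMap) ∘ₗ (Δ α γ).toLinearMap
      = (Δ (β * α * β⁻¹) (β * γ * β⁻¹)).toLinearMap ∘ₗ
        (gcast k H (show β * (α * γ) * β⁻¹ = (β * α * β⁻¹) * (β * γ * β⁻¹) by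
          group)).toLinearMap ∘ₗ (φ β (α * γ)).toLinearMap
  φ_counit : ∀ (β : π) (x : H (1 : π)),
    ε ((gcast k H (show β * 1 * β⁻¹ = (1 : π) by group)) (φ β 1 x)) = ε x
  φ_mul : ∀ (β β' α : π) (x : H α),
    (gcast k H (show β * (β' * α * β'⁻¹) * β⁻¹ = (β * β') * α * (β * β')⁻¹ by group))
        (φ β (β' * α * β'⁻¹) (φ β' α x))
      = φ (β * β') α x


namespace CrossedHopfGCoalgebra

variable (k : Type*) [Field k] {π : Type*} [Group π] (H : π → Type*)
  [∀ α, Ring (H α)] [∀ α, Algebra k (H α)] [CrossedHopfGCoalgebra k H]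

/-- The crossing, with all arguments explicit. -/
def crossing (β α : π) : H α ≃ₐ[k] H (β * α * β⁻¹) := φ β α

end CrossedHopfGCoalgebra

open CrossedHopfGCoalgebra

/-- A quasitriangular Hopf `π`-coalgebra: a crossed Hopf `π`-coalgebra with an R-matrix. -/
class QTHopfGCoalgebra (k : Type*) [Field k] {π : Type*} [Group π]
    (H : π → Type*) [∀ α, Ring (H α)] [∀ α, Algebra k (H α)]
    extends CrossedHopfGCoalgebra k H where
  Rm : ∀ α β : π, H α ⊗[k] H β
  Rm_isUnit : ∀ α β : π, IsUnit (Rm α β)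
  Rm_comul : ∀ (α β : π) (x : H (α * β)),
    Rm α β * Δ α β x
      = (TensorProduct.comm k (H β) (H α))
          ((TensorProduct.map
              ((gcast k H (show α⁻¹ * (α * β * α⁻¹) * α⁻¹⁻¹ = β by group)).toLinearMap ∘ₗ
                (φ α⁻¹ (α * β * α⁻¹)).toLinearMap)
              (LinearMap.id : H α →ₗ[k] H α))
            ((Δ (α * β * α⁻¹) α)
              ((gcast k H (show α * β = (α * β * α⁻¹) * α by group)) x))) * Rm α β
  Rm_delta_right : ∀ α β γ : π,
    TensorProduct.map (LinearMap.id : H α →ₗ[k] H α) (Δ β γ).toLinearMap (Rm α (β * γ))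
      = (TensorProduct.map (LinearMap.id : H α →ₗ[k] H α)
            (TensorProduct.mk k (H β) (H γ) 1) (Rm α γ))
        * (TensorProduct.map (LinearMap.id : H α →ₗ[k] H α)
            ((TensorProduct.mk k (H β) (H γ)).flip 1) (Rm α β))
  Rm_delta_left : ∀ α β γ : π,
    (TensorProduct.assoc k (H α) (H β) (H γ))
        (TensorProduct.map (Δ α β).toLinearMap (LinearMap.id : H γ →ₗ[k] H γ)
          (Rm (α * β) γ))
      = (TensorProduct.map (LinearMap.id : H α →ₗ[k] H α)
            (TensorProduct.mk k (H β) (H γ) 1)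
            (TensorProduct.map (LinearMap.id : H α →ₗ[k] H α)
              ((gcast k H (show β⁻¹ * (β * γ * β⁻¹) * β⁻¹⁻¹ = γ by group)).toLinearMap ∘ₗ
                (φ β⁻¹ (β * γ * β⁻¹)).toLinearMap)
              (Rm α (β * γ * β⁻¹))))
        * (TensorProduct.mk k (H α) (H β ⊗[k] H γ) 1 (Rm β γ))
  Rm_phi : ∀ β α γ : π,
    TensorProduct.map (φ β α).toLinearMap (φ β γ).toLinearMap (Rm α γ)
      = Rm (β * α * β⁻¹) (β * γ * β⁻¹)

namespace QTHopfGCoalgebra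

variable (k : Type*) [Field k] {π : Type*} [Group π] (H : π → Type*)
  [∀ α, Ring (H α)] [∀ α, Algebra k (H α)] [QTHopfGCoalgebra k H]

/-- The square of the antipode `S_{α⁻¹} ∘ S_α : H α → H α`. -/
def antipodeSq (α : π) : H α →ₗ[k] H α :=
  (gcast k H (inv_inv α)).toLinearMap ∘ₗ S α⁻¹ ∘ₗ S α

/-- The map `S_{α⁻¹} ∘ φ_α : H (α⁻¹) → H α`. -/
def sphi (α : π) : H α⁻¹ →ₗ[k] H α :=
  (gcast k H (inv_inv α)).toLinearMap ∘ₗ S α⁻¹ ∘ₗ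
    (gcast k H (show α * α⁻¹ * α⁻¹ = α⁻¹ by group)).toLinearMap ∘ₗ
    (φ α α⁻¹).toLinearMap

/-- The Drinfeld element `u_α = m_α ∘ (S_{α⁻¹}φ_α ⊗ id) ∘ σ_{α,α⁻¹} (R_{α,α⁻¹})`. -/
def drinfeld (α : π) : H α :=
  LinearMap.mul' k (H α)
    (TensorProduct.map (sphi k H α) (LinearMap.id : H α →ₗ[k] H α)
      ((TensorProduct.comm k (H α) (H α⁻¹)) (Rm α α⁻¹)))

/-- The element `S_{α⁻¹}(u_{α⁻¹}) ∈ H α`. -/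
def sdrinfeld (α : π) : H α :=
  (gcast k H (inv_inv α)) (S (k := k) (H := H) α⁻¹ (drinfeld k H α⁻¹))

/-- The `π`-grouplike element `ℓ_α = S_{α⁻¹}(u_{α⁻¹})⁻¹ u_α`. -/
def ell (α : π) : H α :=
  Ring.inverse (sdrinfeld k H α) * drinfeld k H α


/-- The R-matrix, with all arguments explicit. -/
def rmatrix (α β : π) : H α ⊗[k] H β := Rm α β

end QTHopfGCoalgebra

open QTHopfGCoalgebra

namespace HopfGCoalgebra

theorem nontrivial_one (k : Type*) [Field k] {π : Type*} [Group π] (H : π → Type*)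
    [∀ α, Ring (H α)] [∀ α, Algebra k (H α)] [HopfGCoalgebra k H] :
    Nontrivial (H (1 : π)) :=
  (counit k H).toRingHom.domain_nontrivial

theorem nontrivial_mul (k : Type*) [Field k] {π : Type*} [Group π] (H : π → Type*)
    [∀ α, Ring (H α)] [∀ α, Algebra k (H α)] [HopfGCoalgebra k H]
    {α β : π} (hα : Nontrivial (H α)) (hβ : Nontrivial (H β)) :
    Nontrivial (H (α * β)) :=
  have : Nontrivial (H α ⊗[k] H β) := inferInstance
  (comul k H α β).toRingHom.domain_nontrivial

/-- If `H α⁻¹ = 0`, the antipode axiom at `α` gives `1 = 0` in `H α`. -/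
theorem nontrivial_inv (k : Type*) [Field k] {π : Type*} [Group π] (H : π → Type*)
    [∀ α, Ring (H α)] [∀ α, Algebra k (H α)] [HopfGCoalgebra k H]
    {α : π} (hα : Nontrivial (H α)) : Nontrivial (H α⁻¹) := by
  by_contra h
  have : Subsingleton (H α⁻¹) := not_nontrivial_iff_subsingleton.mp h
  have hzero : Δ (k := k) (H := H) α⁻¹ α 1 = 0 := Subsingleton.elim _ _
  have hone := LinearMap.congr_fun (antipode_left (k := k) (H := H) α) 1
  simp only [LinearMap.comp_apply, AlgHom.toLinearMap_apply, AlgEquiv.toLinearMap_apply,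
    hzero, map_zero, map_one, Algebra.linearMap_apply] at hone
  exact zero_ne_one hone

end HopfGCoalgebra

/-- Corollary 1.2: the set of `α ∈ π` with `H α ≠ 0` is a subgroup of `π`. -/
theorem support_is_subgroup (k : Type*) [Field k] {π : Type*} [Group π]
    (H : π → Type*) [∀ α, Ring (H α)] [∀ α, Algebra k (H α)] [HopfGCoalgebra k H] :
    ∃ G : Subgroup π, ∀ α : π, α ∈ G ↔ Nontrivial (H α) := by
  exact ⟨{ carrier := {α | Nontrivial (H α)}
           one_mem' := nontrivial_one k H
           mul_mem' := nontrivial_mul k H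
           inv_mem' := nontrivial_inv k H }, fun _ => Iff.rfl⟩
end
end

section
/- Let H be a Hopf π-coalgebra over a field k and let M be a right Hopf π-comodule over H with structure maps ρ = {ρ_{α,β}}. Then the family f = {f_α : M_α^{coH} ⊗ H_α → M_α}_{α∈π} defined by f_α(m ⊗ h) = m·h is an isomorphism of right Hopf π-comodules from the trivial Hopf π-comodule M^{coH} ⊗ H onto M; that is, each f_α is a bijective H_α-linear map and ρ_{α,β} ∘ f_{αβ} = (f_α ⊗ id_{H_β}) ∘ ξ_{α,β} for all α, β ∈ π. -/
open scoped TensorProduct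

noncomputable section

open HopfGCoalgebra
namespace HopfGComodule

variable (k : Type*) [Field k] {π : Type*} [Group π] (H : π → Type*)
  [∀ α, Ring (H α)] [∀ α, Algebra k (H α)] [HopfGCoalgebra k H]
  (M : π → Type*) [∀ α, AddCommGroup (M α)] [∀ α, Module k (M α)] [HopfGComodule k H M]

/-- The comodule structure maps, with all arguments explicit. -/
def coact (α β : π) : M (α * β) →ₗ[k] M α ⊗[k] H β := ρ α β

/-- The right `H α`-action on `M α`, with all arguments explicit. -/
def hact (α : π) : M α →ₗ[k] H α →ₗ[k] M α := act α

end HopfGComodule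

open CrossedHopfGCoalgebra

open QTHopfGCoalgebra

theorem gcast_gcast (k : Type*) [CommSemiring k] {π : Type*} (H : π → Type*)
    [∀ α, Ring (H α)] [∀ α, Algebra k (H α)] {a b : π} (h : a = b) (h' : b = a) (x : H a) :
    gcast k H h' (gcast k H h x) = x := by
  subst h; rfl

namespace HopfGCoalgebra

variable (k : Type*) [Field k] {π : Type*} [Group π] (H : π → Type*)
  [∀ α, Ring (H α)] [∀ α, Algebra k (H α)] [HopfGCoalgebra k H]

/-- The comultiplication `H γ → H α ⊗ H β` along a factorization `α * β = γ`. -/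
def comulOf {α β γ : π} (h : α * β = γ) : H γ →ₗ[k] H α ⊗[k] H β :=
  (Δ α β).toLinearMap ∘ₗ (gcast k H h.symm).toLinearMap

theorem comulOf_rfl (α β : π) :
    comulOf k H (rfl : α * β = α * β) = (Δ α β).toLinearMap := rfl

/-- The antipode viewed as a map `H α⁻¹ → H α`. -/
def antipodeInv (α : π) : H α⁻¹ →ₗ[k] H α :=
  (gcast k H (inv_inv α)).toLinearMap ∘ₗ S α⁻¹

theorem mul_id_antipodeInv_comulOf (α : π) (x : H (1 : π)) :
    LinearMap.mul' k (H α) (TensorProduct.map LinearMap.id (antipodeInv k H α)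
      (comulOf k H (mul_inv_cancel α) x)) = ε (k := k) x • 1 := by
  have := LinearMap.congr_fun (antipode_right (k := k) (H := H) α)
    (gcast k H (mul_inv_cancel α).symm x)
  simpa [antipodeInv, comulOf, gcast_gcast, Algebra.algebraMap_eq_smul_one] using this

theorem mul_antipodeInv_id_comulOf (α : π) (x : H (1 : π)) :
    LinearMap.mul' k (H α) (TensorProduct.map (antipodeInv k H α) LinearMap.id
      (comulOf k H (inv_mul_cancel α) x)) = ε (k := k) x • 1 := by
  have := LinearMap.congr_fun (antipode_left (k := k) (H := H) α)
    (gcast k H (inv_mul_cancel α).symm x)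
  simpa [antipodeInv, comulOf, gcast_gcast, Algebra.algebraMap_eq_smul_one] using this

theorem lid_counit_comulOf (α : π) (x : H α) :
    TensorProduct.lid k (H α) (TensorProduct.map (ε (k := k) (H := H)).toLinearMap
      LinearMap.id (comulOf k H (one_mul α) x)) = x :=
  LinearMap.congr_fun (counit_left (k := k) (H := H) α) x

end HopfGCoalgebra

namespace HopfGComodule

variable (k : Type*) [Field k] {π : Type*} [Group π] (H : π → Type*)
  [∀ α, Ring (H α)] [∀ α, Algebra k (H α)] [HopfGCoalgebra k H]
  (M : π → Type*) [∀ α, AddCommGroup (M α)] [∀ α, Module k (M α)] [HopfGComodule k H M]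

/-- The coaction `M γ → M α ⊗ H β` along a factorization `α * β = γ`. -/
def coactOf {α β γ : π} (h : α * β = γ) : M γ →ₗ[k] M α ⊗[k] H β :=
  ρ α β ∘ₗ (fcast k M h.symm).toLinearMap

theorem coactOf_rfl (α β : π) :
    coactOf k H M (rfl : α * β = α * β) = ρ α β := rfl

theorem assoc_coactOf {α β γ δ ζ η : π} (h₁ : α * β = δ) (h₂ : δ * γ = η)
    (h₃ : β * γ = ζ) (h₄ : α * ζ = η) (m : M η) :
    TensorProduct.assoc k (M α) (H β) (H γ)
        (TensorProduct.map (coactOf k H M h₁) LinearMap.id (coactOf k H M h₂ m))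
      = TensorProduct.map LinearMap.id (comulOf k H h₃) (coactOf k H M h₄ m) := by
  subst h₁ h₃ h₂
  exact LinearMap.congr_fun (ρ_coassoc (k := k) (H := H) (M := M) α β γ) m

theorem rid_counit_coactOf (α : π) (m : M α) :
    TensorProduct.rid k (M α) (TensorProduct.map LinearMap.id
      (ε (k := k) (H := H)).toLinearMap (coactOf k H M (mul_one α) m)) = m :=
  LinearMap.congr_fun (ρ_counit (k := k) (H := H) (M := M) α) m

/-- The map `m ↦ m₍₀₎ · S(m₍₁₎)` from `M 1` to `M α`. -/
def coinvProj (α : π) : M (1 : π) →ₗ[k] M α :=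
  TensorProduct.lift (hact k H M α) ∘ₗ
    TensorProduct.map LinearMap.id (antipodeInv k H α) ∘ₗ coactOf k H M (mul_inv_cancel α)

theorem lift_map_coinvProj_coactOf (α : π) (m : M α) :
    TensorProduct.lift (hact k H M α) (TensorProduct.map (coinvProj k H M α) LinearMap.id
      (coactOf k H M (one_mul α) m)) = m := by
  have key : ∀ z : (M α ⊗[k] H α⁻¹) ⊗[k] H α,
      TensorProduct.lift (hact k H M α) (TensorProduct.map
        (TensorProduct.lift (hact k H M α) ∘ₗ
          TensorProduct.map LinearMap.id (antipodeInv k H α)) LinearMap.id z)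
      = TensorProduct.lift (hact k H M α) (TensorProduct.map LinearMap.id
          (LinearMap.mul' k (H α) ∘ₗ TensorProduct.map (antipodeInv k H α) LinearMap.id)
          (TensorProduct.assoc k _ _ _ z)) := by
    intro z
    induction z with
    | zero => simp
    | add _ _ h₁ h₂ => simp only [map_add, h₁, h₂]
    | tmul z w =>
      induction z with
      | zero => simp
      | add _ _ h₁ h₂ => simp only [map_add, TensorProduct.add_tmul, h₁, h₂]
      | tmul x y => simp [hact, act_mul]
  have counit_key : ∀ y : M α ⊗[k] H (1 : π),
      TensorProduct.lift (hact k H M α) (TensorProduct.map LinearMap.id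
        ((LinearMap.mul' k (H α) ∘ₗ TensorProduct.map (antipodeInv k H α) LinearMap.id) ∘ₗ
          comulOf k H (inv_mul_cancel α)) y)
      = TensorProduct.rid k (M α) (TensorProduct.map LinearMap.id
          (ε (k := k) (H := H)).toLinearMap y) := by
    intro y
    induction y with
    | zero => simp
    | add _ _ h₁ h₂ => simp only [map_add, h₁, h₂]
    | tmul x y => simp [mul_antipodeInv_id_comulOf, hact, act_one]
  have split : TensorProduct.map (coinvProj k H M α) (LinearMap.id : H α →ₗ[k] H α)
      = TensorProduct.map (TensorProduct.lift (hact k H M α) ∘ₗ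
          TensorProduct.map LinearMap.id (antipodeInv k H α)) LinearMap.id ∘ₗ
        TensorProduct.map (coactOf k H M (mul_inv_cancel α)) LinearMap.id := by
    rw [← TensorProduct.map_comp]; rfl
  rw [split, LinearMap.comp_apply, key,
    assoc_coactOf k H M (mul_inv_cancel α) (one_mul α) (inv_mul_cancel α) (mul_one α),
    ← LinearMap.comp_apply (TensorProduct.map _ _) (TensorProduct.map _ _),
    ← TensorProduct.map_comp, LinearMap.id_comp, counit_key, rid_counit_coactOf]

/-- A linear map `A` from `M 1` to a right `H γ`-module is recovered from the map
`m ↦ A(m₍₀₎) · m₍₁₎` on `M γ`. -/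
theorem lift_map_lift_map_coactOf (γ : π) {N : Type*} [AddCommGroup N] [Module k N]
    (a : N →ₗ[k] H γ →ₗ[k] N) (a_one : ∀ n, a n 1 = n)
    (a_mul : ∀ n x y, a (a n x) y = a n (x * y)) (A : M (1 : π) →ₗ[k] N) (m : M (1 : π)) :
    TensorProduct.lift a (TensorProduct.map
      (TensorProduct.lift a ∘ₗ TensorProduct.map A LinearMap.id ∘ₗ coactOf k H M (one_mul γ))
      (antipodeInv k H γ) (coactOf k H M (mul_inv_cancel γ) m)) = A m := by
  have key : ∀ z : (M (1 : π) ⊗[k] H γ) ⊗[k] H γ⁻¹,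
      TensorProduct.lift a (TensorProduct.map
        (TensorProduct.lift a ∘ₗ TensorProduct.map A LinearMap.id) (antipodeInv k H γ) z)
      = TensorProduct.lift a (TensorProduct.map A
          (LinearMap.mul' k (H γ) ∘ₗ TensorProduct.map LinearMap.id (antipodeInv k H γ))
          (TensorProduct.assoc k _ _ _ z)) := by
    intro z
    induction z with
    | zero => simp
    | add _ _ h₁ h₂ => simp only [map_add, h₁, h₂]
    | tmul z w =>
      induction z with
      | zero => simp
      | add _ _ h₁ h₂ => simp only [map_add, TensorProduct.add_tmul, h₁, h₂]
      | tmul x y => simp [a_mul]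
  have counit_key : ∀ y : M (1 : π) ⊗[k] H (1 : π),
      TensorProduct.lift a (TensorProduct.map A
        ((LinearMap.mul' k (H γ) ∘ₗ TensorProduct.map LinearMap.id (antipodeInv k H γ)) ∘ₗ
          comulOf k H (mul_inv_cancel γ)) y)
      = A (TensorProduct.rid k (M 1) (TensorProduct.map LinearMap.id
          (ε (k := k) (H := H)).toLinearMap y)) := by
    intro y
    induction y with
    | zero => simp
    | add _ _ h₁ h₂ => simp only [map_add, h₁, h₂]
    | tmul x y => simp [mul_id_antipodeInv_comulOf, a_one]
  have split : TensorProduct.map (TensorProduct.lift a ∘ₗ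
        TensorProduct.map A LinearMap.id ∘ₗ coactOf k H M (one_mul γ)) (antipodeInv k H γ)
      = TensorProduct.map (TensorProduct.lift a ∘ₗ TensorProduct.map A LinearMap.id)
          (antipodeInv k H γ) ∘ₗ
        TensorProduct.map (coactOf k H M (one_mul γ)) LinearMap.id := by
    rw [← TensorProduct.map_comp]; rfl
  rw [split, LinearMap.comp_apply, key,
    assoc_coactOf k H M (one_mul γ) (mul_inv_cancel γ) (mul_inv_cancel γ) (mul_one 1),
    ← LinearMap.comp_apply (TensorProduct.map _ _) (TensorProduct.map _ _),
    ← TensorProduct.map_comp, LinearMap.comp_id, counit_key, rid_counit_coactOf]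

/-- The componentwise right action of `H α ⊗ H β` on `M α ⊗ H β`. -/
def tensorAct (α β : π) : M α ⊗[k] H β →ₗ[k] H α ⊗[k] H β →ₗ[k] M α ⊗[k] H β :=
  TensorProduct.curry
    (TensorProduct.map (TensorProduct.lift (hact k H M α)) (LinearMap.mul' k (H β)) ∘ₗ
      (TensorProduct.tensorTensorTensorComm k (M α) (H β) (H α) (H β)).toLinearMap)

theorem tensorAct_tmul_tmul (α β : π) (m : M α) (b : H β) (x : H α) (y : H β) :
    tensorAct k H M α β (m ⊗ₜ b) (x ⊗ₜ y) = hact k H M α m x ⊗ₜ (b * y) := by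
  simp [tensorAct]

theorem tensorAct_one (α β : π) (n : M α ⊗[k] H β) : tensorAct k H M α β n 1 = n := by
  induction n with
  | zero => simp
  | add _ _ h₁ h₂ => simp only [map_add, LinearMap.add_apply, h₁, h₂]
  | tmul m b =>
    rw [Algebra.TensorProduct.one_def, tensorAct_tmul_tmul]
    simp [hact, act_one]

theorem tensorAct_tensorAct (α β : π) (n : M α ⊗[k] H β) (x y : H α ⊗[k] H β) :
    tensorAct k H M α β (tensorAct k H M α β n x) y = tensorAct k H M α β n (x * y) := by
  induction n with
  | zero => simp
  | add _ _ h₁ h₂ => simp only [map_add, LinearMap.add_apply, h₁, h₂]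
  | tmul m b =>
    induction x with
    | zero => simp
    | add _ _ h₁ h₂ => simp only [map_add, LinearMap.add_apply, add_mul, h₁, h₂]
    | tmul x x' =>
      induction y with
      | zero => simp
      | add _ _ h₁ h₂ => simp only [map_add, mul_add, h₁, h₂]
      | tmul y y' =>
        simp [tensorAct_tmul_tmul, hact, act_mul, mul_assoc]

theorem tensorAct_tmul_one (α β : π) (m : M α) (x : H α ⊗[k] H β) :
    tensorAct k H M α β (m ⊗ₜ 1) x = TensorProduct.map (hact k H M α m) LinearMap.id x := by
  induction x with
  | zero => simp
  | add _ _ h₁ h₂ => simp only [map_add, h₁, h₂]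
  | tmul x y => simp [tensorAct_tmul_tmul]

theorem ρ_hact (α β : π) (m : M (α * β)) (a : H (α * β)) :
    ρ α β (hact k H M (α * β) m a) = tensorAct k H M α β (ρ α β m) (Δ α β a) :=
  ρ_act α β m a

theorem coinvProj_mem_coinvFam (m : M (1 : π)) :
    (fun α => coinvProj k H M α m) ∈ coinvFam k H M := by
  intro α β
  let a : M α ⊗[k] H β →ₗ[k] H (α * β) →ₗ[k] M α ⊗[k] H β :=
    (tensorAct k H M α β).compl₂ (Δ α β).toLinearMap
  let A := ρ (k := k) (H := H) (M := M) α β ∘ₗ coinvProj k H M (α * β)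
  let B := (TensorProduct.mk k (M α) (H β)).flip 1 ∘ₗ coinvProj k H M α
  have a_one : ∀ n, a n 1 = n := fun n => by simp [a, tensorAct_one]
  have a_mul : ∀ n x y, a (a n x) y = a n (x * y) := fun n x y => by
    simp [a, tensorAct_tensorAct]
  have hA : TensorProduct.lift a ∘ₗ TensorProduct.map A LinearMap.id ∘ₗ
      coactOf k H M (one_mul (α * β)) = ρ α β := by
    have h : TensorProduct.lift a ∘ₗ TensorProduct.map A LinearMap.id
        = ρ (k := k) (H := H) (M := M) α β ∘ₗ
          TensorProduct.lift (hact k H M (α * β)) ∘ₗ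
          TensorProduct.map (coinvProj k H M (α * β)) LinearMap.id := by
      ext x y
      simp [a, A, ρ_hact]
    rw [← LinearMap.comp_assoc, h]
    ext x
    simp [lift_map_coinvProj_coactOf]
  have hB : TensorProduct.lift a ∘ₗ TensorProduct.map B LinearMap.id ∘ₗ
      coactOf k H M (one_mul (α * β)) = ρ α β := by
    have h : ∀ z : M (1 : π) ⊗[k] H (α * β),
        TensorProduct.lift a (TensorProduct.map B LinearMap.id z)
        = TensorProduct.map (TensorProduct.lift (hact k H M α) ∘ₗ
            TensorProduct.map (coinvProj k H M α) LinearMap.id) LinearMap.id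
          ((TensorProduct.assoc k _ _ _).symm
            (TensorProduct.map LinearMap.id (Δ α β).toLinearMap z)) := by
      intro z
      induction z with
      | zero => simp
      | add _ _ h₁ h₂ => simp only [map_add, h₁, h₂]
      | tmul x y =>
        simp only [TensorProduct.map_tmul, TensorProduct.lift.tmul, a, B, LinearMap.compl₂_apply,
          LinearMap.comp_apply, LinearMap.flip_apply, TensorProduct.mk_apply, LinearMap.id_apply,
          tensorAct_tmul_one]
        induction (Δ (k := k) (H := H) α β).toLinearMap y with
        | zero => simp
        | add _ _ h₁ h₂ => simp only [map_add, TensorProduct.tmul_add, h₁, h₂]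
        | tmul u v => simp
    ext x
    have hc := assoc_coactOf k H M (one_mul α) (rfl : α * β = α * β) rfl (one_mul (α * β)) x
    rw [LinearMap.comp_apply, LinearMap.comp_apply, h, ← comulOf_rfl, ← hc,
      LinearEquiv.symm_apply_apply,
      ← LinearMap.comp_apply (TensorProduct.map _ _) (TensorProduct.map _ _),
      ← TensorProduct.map_comp, LinearMap.comp_id]
    have hid : (TensorProduct.lift (hact k H M α) ∘ₗ
        TensorProduct.map (coinvProj k H M α) LinearMap.id) ∘ₗ coactOf k H M (one_mul α)
        = LinearMap.id := by
      ext y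
      exact lift_map_coinvProj_coactOf k H M α y
    rw [hid, TensorProduct.map_id, coactOf_rfl, LinearMap.id_apply]
  change A m = B m
  rw [← lift_map_lift_map_coactOf k H M (α * β) a a_one a_mul A m,
    ← lift_map_lift_map_coactOf k H M (α * β) a a_one a_mul B m, hA, hB]

variable {M}

theorem coactOf_hact_of_mem_coinvFam {m : ∀ γ, M γ} (hm : m ∈ coinvFam k H M) {α β γ : π}
    (h : α * β = γ) (x : H γ) :
    coactOf k H M h (hact k H M γ (m γ) x)
      = TensorProduct.map (hact k H M α (m α)) LinearMap.id (comulOf k H h x) := by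
  subst h
  rw [coactOf_rfl, comulOf_rfl, ρ_hact, hm α β, tensorAct_tmul_one]
  rfl

theorem coinvProj_hact {m : ∀ γ, M γ} (hm : m ∈ coinvFam k H M) (α : π) (x : H (1 : π)) :
    coinvProj k H M α (hact k H M 1 (m 1) x) = ε (k := k) x • m α := by
  have h : ∀ z : H α ⊗[k] H α⁻¹,
      TensorProduct.lift (hact k H M α) (TensorProduct.map LinearMap.id (antipodeInv k H α)
        (TensorProduct.map (hact k H M α (m α)) LinearMap.id z))
      = hact k H M α (m α) (LinearMap.mul' k (H α)
        (TensorProduct.map LinearMap.id (antipodeInv k H α) z)) := by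
    intro z
    induction z with
    | zero => simp
    | add _ _ h₁ h₂ => simp only [map_add, h₁, h₂]
    | tmul u v => simp [hact, act_mul]
  rw [coinvProj, LinearMap.comp_apply, LinearMap.comp_apply,
    coactOf_hact_of_mem_coinvFam k H hm, h, mul_id_antipodeInv_comulOf, map_smul]
  simp [hact, act_one]

variable (M)

/-- `coinvProj` with values in the coinvariants. -/
def toCoinvSub (α : π) : M (1 : π) →ₗ[k] coinvSub k H M α :=
  (coinvProj k H M α).codRestrict _ fun m => ⟨_, coinvProj_mem_coinvFam k H M m, rfl⟩

theorem bijective_lift_hact_coinvSub (α : π) : Function.Bijective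
    (TensorProduct.lift ((hact k H M α) ∘ₗ (coinvSub k H M α).subtype)) := by
  refine Function.bijective_iff_has_inverse.2 ⟨fun m => TensorProduct.map (toCoinvSub k H M α)
    LinearMap.id (coactOf k H M (one_mul α) m), ?_, ?_⟩
  · intro z
    dsimp only
    induction z with
    | zero => simp
    | add _ _ h₁ h₂ => simp only [map_add, h₁, h₂]
    | tmul x h =>
      obtain ⟨_, m, hm, rfl⟩ := x
      have key : ∀ w : H (1 : π) ⊗[k] H α,
          TensorProduct.map (toCoinvSub k H M α) LinearMap.id
            (TensorProduct.map (hact k H M 1 (m 1)) LinearMap.id w)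
          = (⟨m α, m, hm, rfl⟩ : coinvSub k H M α) ⊗ₜ[k] TensorProduct.lid k (H α)
            (TensorProduct.map (ε (k := k) (H := H)).toLinearMap LinearMap.id w) := by
        intro w
        induction w with
        | zero => simp
        | add _ _ h₁ h₂ => simp only [map_add, TensorProduct.tmul_add, h₁, h₂]
        | tmul u v =>
          have hu : toCoinvSub k H M α (hact k H M 1 (m 1) u)
              = ε (k := k) u • (⟨m α, m, hm, rfl⟩ : coinvSub k H M α) :=
            Subtype.ext (coinvProj_hact k H hm α u)
          simp [hu, TensorProduct.smul_tmul]
      have hx := coactOf_hact_of_mem_coinvFam k H hm (one_mul α) h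
      simp only [TensorProduct.lift.tmul, LinearMap.comp_apply, Submodule.subtype_apply,
        LinearMap.proj_apply]
      rw [hx, key, lid_counit_comulOf]
  · intro m
    refine Eq.trans ?_ (lift_map_coinvProj_coactOf k H M α m)
    refine LinearMap.congr_fun
      (f := TensorProduct.lift ((hact k H M α) ∘ₗ (coinvSub k H M α).subtype) ∘ₗ _)
      (g := TensorProduct.lift (hact k H M α) ∘ₗ _) ?_ _
    ext x y
    rfl

end HopfGComodule

open HopfGComodule in
/-- Theorem 2.3 (fundamental theorem of Hopf `π`-comodules): the canonical map
`M^{co H} ⊗ H → M`, `m ⊗ h ↦ m · h`, is an isomorphism of right Hopf `π`-comodules. -/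
theorem fundamental_theorem_of_Hopf_comodules (k : Type*) [Field k] {π : Type*} [Group π]
    (H : π → Type*) [∀ α, Ring (H α)] [∀ α, Algebra k (H α)] [HopfGCoalgebra k H]
    (M : π → Type*) [∀ α, AddCommGroup (M α)] [∀ α, Module k (M α)]
    [HopfGComodule k H M] :
    -- each `f_α : M_α^{co H} ⊗ H_α → M_α` is bijective
    (∀ α : π, Function.Bijective
        (TensorProduct.lift ((hact k H M α) ∘ₗ (coinvSub k H M α).subtype))) ∧
    -- each `f_α` is `H_α`-linear, where `(m ⊗ h) · a = m ⊗ (h * a)`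
    (∀ (α : π) (x : coinvSub k H M α) (h a : H α),
        TensorProduct.lift ((hact k H M α) ∘ₗ (coinvSub k H M α).subtype)
            (x ⊗ₜ[k] (h * a))
          = hact k H M α
              (TensorProduct.lift ((hact k H M α) ∘ₗ (coinvSub k H M α).subtype)
                (x ⊗ₜ[k] h)) a) ∧
    -- `f` is a morphism of `π`-comodules:  `ρ_{α,β} ∘ f_{αβ} = (f_α ⊗ id) ∘ ξ_{α,β}`,
    -- expressed on the generators `m_{αβ} ⊗ h` with `m` a coinvariant family
    (∀ (α β : π) (m : ∀ γ, M γ), m ∈ coinvFam k H M → ∀ hh : H (α * β),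
        coact k H M α β (hact k H M (α * β) (m (α * β)) hh)
          = TensorProduct.map (hact k H M α (m α)) (LinearMap.id : H β →ₗ[k] H β)
              (comul k H α β hh)) := by
  exact ⟨bijective_lift_hact_coinvSub k H M,
    fun α x h a => (act_mul α (x : M α) h a).symm,
    fun α β m hm x => coactOf_hact_of_mem_coinvFam k H hm rfl x⟩
end
end

section
/- Let H be a finite dimensional Hopf π-coalgebra over a field k. Then the k-subspace of Π_{α∈π} H_α* consisting of all left (resp. all right) π-integrals for H is one-dimensional. -/
open scoped TensorProduct

noncomputable section

open HopfGCoalgebra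
open CrossedHopfGCoalgebra

open QTHopfGCoalgebra

lemma Module.eq_of_forall_dual_apply_eq (k : Type*) {V : Type*} [Field k] [AddCommGroup V]
    [Module k V] {x y : V} (h : ∀ g : V →ₗ[k] k, g x = g y) : x = y :=
  sub_eq_zero.1 <| (Module.forall_dual_apply_eq_zero_iff k _).1 fun g => by
    rw [map_sub, h g, sub_self]

lemma Module.exists_dual_eq_one (k : Type*) {V : Type*} [Field k] [AddCommGroup V] [Module k V]
    {v : V} (hv : v ≠ 0) : ∃ f : V →ₗ[k] k, f v = 1 := by
  obtain ⟨f, hf⟩ : ∃ f : V →ₗ[k] k, f v ≠ 0 := by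
    by_contra! h
    exact hv ((Module.forall_dual_apply_eq_zero_iff k v).1 h)
  exact ⟨(f v)⁻¹ • f, by simp [hf]⟩

lemma Module.exists_dual_smul_eq (k : Type*) {V : Type*} [Field k] [AddCommGroup V] [Module k V]
    (v : V) : ∃ f : V →ₗ[k] k, ∀ c : k, f (c • v) • v = c • v := by
  by_cases hv : v = 0
  · exact ⟨0, by simp [hv]⟩
  obtain ⟨f, hf⟩ := Module.exists_dual_eq_one k hv
  exact ⟨f, fun c => by simp [hf]⟩

lemma TensorProduct.tmul_left_cancel {k V W : Type*} [Field k] [AddCommGroup V] [Module k V]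
    [AddCommGroup W] [Module k W] {v : V} (hv : v ≠ 0) {x y : W}
    (h : v ⊗ₜ[k] x = v ⊗ₜ[k] y) : x = y := by
  obtain ⟨f, hf⟩ := Module.exists_dual_eq_one k hv
  simpa [hf] using congr(TensorProduct.lid k W (TensorProduct.map f LinearMap.id $h))

lemma TensorProduct.tmul_right_cancel {k V W : Type*} [Field k] [AddCommGroup V] [Module k V]
    [AddCommGroup W] [Module k W] {w : W} (hw : w ≠ 0) {x y : V}
    (h : x ⊗ₜ[k] w = y ⊗ₜ[k] w) : x = y :=
  TensorProduct.tmul_left_cancel (k := k) hw <| by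
    simpa using congr(TensorProduct.comm k V W $h)

namespace HopfAlgebra

open Coalgebra WithConv

variable {k A : Type*} [Field k] [Ring A] [HopfAlgebra k A]

lemma comul_antipode (a : A) :
    Coalgebra.comul (R := k) (antipode k a) =
      TensorProduct.comm k A A (TensorProduct.map (antipode k) (antipode k)
        (Coalgebra.comul a)) := by
  let i₁ : A →ₐ[k] A ⊗[k] A := Algebra.TensorProduct.includeLeft
  let i₂ : A →ₐ[k] A ⊗[k] A := Algebra.TensorProduct.includeRight
  have hδ : toConv (Coalgebra.comul (R := k) (A := A)) =
      toConv i₁.toLinearMap * toConv i₂.toLinearMap := by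
    ext c
    rw [(ℛ k c).convMul_apply]
    simp [i₁, i₂, (ℛ k c).eq]
  have hG : toConv ((TensorProduct.comm k A A).toLinearMap ∘ₗ
        TensorProduct.map (antipode k) (antipode k) ∘ₗ Coalgebra.comul (R := k) (A := A)) =
      toConv (i₂.toLinearMap ∘ₗ antipode k) * toConv (i₁.toLinearMap ∘ₗ antipode k) := by
    ext c
    rw [(ℛ k c).convMul_apply]
    conv_lhs => simp [← (ℛ k c).eq]
    simp [i₁, i₂]
  have hS (i : A →ₐ[k] A ⊗[k] A) :
      toConv (i.toLinearMap ∘ₗ antipode k) * toConv i.toLinearMap = 1 := by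
    have := LinearMap.algHom_comp_convMul_distrib i (toConv (antipode k (A := A)))
      (toConv LinearMap.id)
    rw [LinearMap.antipode_mul_id] at this
    ext c
    have := congr($this c)
    simp at this
    simp [this]
  have hGδ := congr($hG * toConv (Coalgebra.comul (R := k) (A := A)))
  rw [hδ, mul_assoc, ← mul_assoc (toConv (i₁.toLinearMap ∘ₗ _)), hS, one_mul, hS, ← hδ] at hGδ
  have key := left_inv_eq_right_inv hGδ (LinearMap.comul_right_inv (R := k) (C := A))
  exact congr($key a).symm

/-- The operator `a ↦ p(a₁) a₂`. -/
def leftSlice (p : A →ₗ[k] k) : A →ₗ[k] A :=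
  (TensorProduct.lid k A).toLinearMap ∘ₗ TensorProduct.map p LinearMap.id ∘ₗ Coalgebra.comul

/-- The operator `a ↦ a₁ p(a₂)`. -/
def rightSlice (p : A →ₗ[k] k) : A →ₗ[k] A :=
  (TensorProduct.rid k A).toLinearMap ∘ₗ TensorProduct.map LinearMap.id p ∘ₗ Coalgebra.comul

lemma leftSlice_apply {ι : Type*} (p : A →ₗ[k] k) {a : A} (r : Repr k a ι) :
    leftSlice p a = ∑ i ∈ r.index, p (r.left i) • r.right i := by
  simp [leftSlice, ← r.eq]

lemma rightSlice_apply {ι : Type*} (p : A →ₗ[k] k) {a : A} (r : Repr k a ι) :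
    rightSlice p a = ∑ i ∈ r.index, p (r.right i) • r.left i := by
  simp [rightSlice, ← r.eq]

lemma apply_rightSlice (p q : A →ₗ[k] k) (a : A) :
    p (rightSlice q a) = q (leftSlice p a) := by
  simp [rightSlice_apply q (ℛ k a), leftSlice_apply p (ℛ k a), mul_comm]

lemma leftSlice_counit : leftSlice (Coalgebra.counit (R := k) (A := A)) = LinearMap.id := by
  ext a
  simp [leftSlice_apply _ (ℛ k a), sum_counit_smul]

lemma rightSlice_counit : rightSlice (Coalgebra.counit (R := k) (A := A)) = LinearMap.id := by
  ext a
  have h := congr(TensorProduct.rid k A $(lTensor_counit_comul (R := k) a))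
  simpa [rightSlice, LinearMap.lTensor] using h

lemma counit_leftSlice (p : A →ₗ[k] k) (a : A) :
    Coalgebra.counit (R := k) (leftSlice p a) = p a := by
  rw [← apply_rightSlice, rightSlice_counit, LinearMap.id_apply]

lemma leftSlice_leftSlice (p q : A →ₗ[k] k) (a : A) :
    leftSlice p (leftSlice q a) = leftSlice (toConv q * toConv p).ofConv a := by
  let T : A ⊗[k] (A ⊗[k] A) →ₗ[k] A := (TensorProduct.lid k A).toLinearMap ∘ₗ
    TensorProduct.map q ((TensorProduct.lid k A).toLinearMap ∘ₗ TensorProduct.map p LinearMap.id)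
  have h₁ (t : A ⊗[k] A) : leftSlice p (TensorProduct.lid k A (TensorProduct.map q .id t)) =
      T (Coalgebra.comul.lTensor A t) := by
    induction t with
    | zero => simp
    | add x y hx hy => simp only [map_add, hx, hy]
    | tmul x y => simp [T, leftSlice]
  have h₂ (t : A ⊗[k] A) :
      TensorProduct.lid k A (TensorProduct.map (toConv q * toConv p).ofConv .id t) =
        T (TensorProduct.assoc k A A A (Coalgebra.comul.rTensor A t)) := by
    induction t with
    | zero => simp
    | add x y hx hy => simp only [map_add, hx, hy]
    | tmul x y =>
      rw [TensorProduct.map_tmul, (ℛ k x).convMul_apply, LinearMap.rTensor_tmul]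
      conv_rhs => rw [← (ℛ k x).eq]
      simp [T, TensorProduct.sum_tmul, mul_smul]
      exact Finset.sum_congr rfl fun _ _ => smul_comm _ _ _
  refine (h₁ _).trans (Eq.trans ?_ (h₂ _).symm)
  rw [coassoc_apply]

lemma leftSlice_rightSlice (p q : A →ₗ[k] k) (a : A) :
    leftSlice p (rightSlice q a) = rightSlice q (leftSlice p a) := by
  let T : A ⊗[k] (A ⊗[k] A) →ₗ[k] A := (TensorProduct.lid k A).toLinearMap ∘ₗ
    TensorProduct.map p ((TensorProduct.rid k A).toLinearMap ∘ₗ TensorProduct.map LinearMap.id q)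
  have h₁ (t : A ⊗[k] A) : rightSlice q (TensorProduct.lid k A (TensorProduct.map p .id t)) =
      T (Coalgebra.comul.lTensor A t) := by
    induction t with
    | zero => simp
    | add x y hx hy => simp only [map_add, hx, hy]
    | tmul x y => simp [T, rightSlice]
  have h₂ (t : A ⊗[k] A) : leftSlice p (TensorProduct.rid k A (TensorProduct.map .id q t)) =
        T (TensorProduct.assoc k A A A (Coalgebra.comul.rTensor A t)) := by
    induction t with
    | zero => simp
    | add x y hx hy => simp only [map_add, hx, hy]
    | tmul x y =>
      simp only [TensorProduct.map_tmul, TensorProduct.rid_tmul, map_smul, LinearMap.id_apply,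
        LinearMap.rTensor_tmul]
      rw [leftSlice_apply p (ℛ k x)]
      conv_rhs => rw [← (ℛ k x).eq]
      simp [T, TensorProduct.sum_tmul, Finset.smul_sum]
  refine (h₂ _).trans (Eq.trans ?_ (h₁ _).symm)
  rw [coassoc_apply]

lemma comul_antipode_eq_sum {ι : Type*} {a : A} (r : Repr k a ι) :
    Coalgebra.comul (R := k) (antipode k a) =
      ∑ i ∈ r.index, antipode k (r.right i) ⊗ₜ[k] antipode k (r.left i) := by
  rw [comul_antipode, ← r.eq]
  simp

lemma leftSlice_antipode (p : A →ₗ[k] k) (a : A) :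
    leftSlice p (antipode k a) = antipode k (rightSlice (p ∘ₗ antipode k) a) := by
  rw [rightSlice_apply _ (ℛ k a)]
  simp [leftSlice, comul_antipode_eq_sum (ℛ k a)]

lemma rightSlice_antipode (p : A →ₗ[k] k) (a : A) :
    rightSlice p (antipode k a) = antipode k (leftSlice (p ∘ₗ antipode k) a) := by
  rw [leftSlice_apply _ (ℛ k a)]
  simp [rightSlice, comul_antipode_eq_sum (ℛ k a)]

lemma leftSlice_mul {ι : Type*} (p : A →ₗ[k] k) {a : A} (r : Repr k a ι) (b : A) :
    leftSlice p (a * b) =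
      ∑ i ∈ r.index, r.right i * leftSlice (p ∘ₗ LinearMap.mulLeft k (r.left i)) b := by
  have h : ∑ i ∈ r.index, r.right i * leftSlice (p ∘ₗ LinearMap.mulLeft k (r.left i)) b =
      ∑ i ∈ r.index, ∑ j ∈ (ℛ k b).index,
        p (r.left i * (ℛ k b).left j) • (r.right i * (ℛ k b).right j) := by
    simp [leftSlice_apply _ (ℛ k b), Finset.mul_sum]
  rw [h]
  simp [leftSlice, Bialgebra.comul_mul, ← r.eq, ← (ℛ k b).eq, Finset.sum_mul_sum]

lemma sum_antipode_antipode_mul {ι : Type*} {a : A} (r : Repr k a ι) :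
    ∑ i ∈ r.index, antipode k (antipode k (r.right i)) * antipode k (r.left i) =
      algebraMap k A (Coalgebra.counit a) := by
  have := mul_antipode_rTensor_comul_apply (R := k) (antipode k a)
  simpa [comul_antipode_eq_sum r] using this

lemma sum_mul_antipode_antipode {ι : Type*} {a : A} (r : Repr k a ι) :
    ∑ i ∈ r.index, antipode k (r.right i) * antipode k (antipode k (r.left i)) =
      algebraMap k A (Coalgebra.counit a) := by
  have := mul_antipode_lTensor_comul_apply (R := k) (antipode k a)
  simpa [comul_antipode_eq_sum r] using this

lemma leftSlice_sum {ι : Type*} (s : Finset ι) (p : ι → A →ₗ[k] k) (a : A) :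
    leftSlice (∑ j ∈ s, p j) a = ∑ j ∈ s, leftSlice (p j) a := by
  simp only [leftSlice_apply _ (ℛ k a), LinearMap.sum_apply, Finset.sum_smul]
  exact Finset.sum_comm

lemma leftSlice_smul (c : k) (p : A →ₗ[k] k) (a : A) :
    leftSlice (c • p) a = c • leftSlice p a := by
  simp [leftSlice_apply _ (ℛ k a), Finset.smul_sum, mul_smul]

lemma leftSlice_antipode_antipode (p : A →ₗ[k] k) (a : A) :
    leftSlice p (antipode k (antipode k a)) =
      antipode k (antipode k (leftSlice (p ∘ₗ antipode k ∘ₗ antipode k) a)) := by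
  rw [leftSlice_antipode, rightSlice_antipode]
  rfl

lemma sum_coord_mul {ι : Type*} [Fintype ι] (b : Module.Basis ι k A) (g : A →ₗ[k] k) (u v : A) :
    ∑ j, b.coord j u * g (b j * v) = g (u * v) := by
  conv_rhs => rw [← b.sum_repr u]
  simp only [Finset.sum_mul, map_sum, smul_mul_assoc, map_smul, smul_eq_mul, b.coord_apply]

lemma antipode_eq_sum_coord {ι : Type*} [Fintype ι] (b : Module.Basis ι k A) (a : A) :
    antipode k a = ∑ j, b.coord j a • antipode k (b j) := by
  conv_lhs => rw [← b.sum_repr a]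
  simp only [map_sum, map_smul, b.coord_apply]

/-- The functional `h ↦ tr (a ↦ h S²(a₁) f(a₂))`. -/
def traceForm (f : A →ₗ[k] k) : A →ₗ[k] k :=
  LinearMap.trace k A ∘ₗ
    LinearMap.lcomp k A (antipode k ∘ₗ antipode k ∘ₗ rightSlice f) ∘ₗ LinearMap.mul k A

lemma traceForm_apply (f : A →ₗ[k] k) (h : A) :
    traceForm f h = LinearMap.trace k A
      (LinearMap.mulLeft k h ∘ₗ antipode k ∘ₗ antipode k ∘ₗ rightSlice f) := rfl

section
variable {ι : Type*} [Fintype ι] (b : Module.Basis ι k A) (g : A →ₗ[k] k)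

lemma sum_leftSlice_leftSlice_coord (a : A) :
    ∑ j, leftSlice (g ∘ₗ LinearMap.mulLeft k (b j) ∘ₗ antipode k) (leftSlice (b.coord j) a) =
      g 1 • a := by
  have h : ∑ j, (toConv (b.coord j) *
      toConv (g ∘ₗ LinearMap.mulLeft k (b j) ∘ₗ antipode k)).ofConv =
      g 1 • Coalgebra.counit (R := k) (A := A) := by
    ext y
    have := congr(g $(sum_mul_antipode_eq_algebraMap_counit (ℛ k y)))
    simp only [map_sum, Algebra.algebraMap_eq_smul_one, map_smul] at this
    simp only [LinearMap.sum_apply, (ℛ k y).convMul_apply]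
    rw [Finset.sum_comm]
    simp only [LinearMap.comp_apply, LinearMap.mulLeft_apply, sum_coord_mul, this,
      LinearMap.smul_apply, smul_eq_mul, mul_comm]
  simp only [leftSlice_leftSlice]
  rw [← leftSlice_sum, h, leftSlice_smul, leftSlice_counit, LinearMap.id_apply]

lemma sum_leftSlice_coord_mul (f : A →ₗ[k] k) (h y : A) :
    ∑ j, leftSlice (b.coord j) (h * antipode k (antipode k (rightSlice f
      (leftSlice (g ∘ₗ LinearMap.mulLeft k (b j) ∘ₗ antipode k) y)))) =
      leftSlice g h * antipode k (antipode k (rightSlice f y)) := by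
  have key (x : A) : ∑ j, (toConv (g ∘ₗ LinearMap.mulLeft k (b j) ∘ₗ antipode k) *
      toConv ((b.coord j ∘ₗ LinearMap.mulLeft k x) ∘ₗ antipode k ∘ₗ antipode k)).ofConv =
      g x • Coalgebra.counit (R := k) (A := A) := by
    ext y
    have := congr(g (x * $(sum_antipode_antipode_mul (ℛ k y))))
    simp only [Finset.mul_sum, ← mul_assoc, map_sum,
      Algebra.algebraMap_eq_smul_one, mul_smul_comm, mul_one, map_smul] at this
    simp only [LinearMap.sum_apply, (ℛ k y).convMul_apply]
    rw [Finset.sum_comm]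
    simp only [LinearMap.comp_apply, LinearMap.mulLeft_apply, mul_comm (g _) (b.coord _ _),
      sum_coord_mul, this, LinearMap.smul_apply, smul_eq_mul, mul_comm]
  simp only [leftSlice_mul _ (ℛ k h), leftSlice_antipode_antipode, leftSlice_rightSlice,
    leftSlice_leftSlice]
  rw [Finset.sum_comm]
  simp only [← Finset.mul_sum, ← map_sum, ← leftSlice_sum, key, leftSlice_smul, leftSlice_counit]
  simp [leftSlice_apply _ (ℛ k h), Finset.sum_mul]

end

section FiniteDimensional
variable [FiniteDimensional k A]

lemma traceForm_leftSlice (f g : A →ₗ[k] k) (h : A) :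
    traceForm f (leftSlice g h) = g 1 * traceForm f h := by
  let b := Module.finBasis k A
  let D : Module.End k A := LinearMap.mulLeft k h ∘ₗ antipode k ∘ₗ antipode k ∘ₗ rightSlice f
  let P j : Module.End k A := leftSlice (b.coord j)
  let Q j : Module.End k A := leftSlice (g ∘ₗ LinearMap.mulLeft k (b j) ∘ₗ antipode k)
  have h₁ : ∑ j, P j * (D * Q j) =
      LinearMap.mulLeft k (leftSlice g h) ∘ₗ antipode k ∘ₗ antipode k ∘ₗ rightSlice f := by
    ext y
    simpa [P, Q, D] using sum_leftSlice_coord_mul b g f h y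
  have h₂ : ∑ j, Q j * P j = g 1 • (1 : Module.End k A) := by
    ext y
    simpa [P, Q] using sum_leftSlice_leftSlice_coord b g y
  rw [traceForm_apply, ← h₁, map_sum]
  simp only [LinearMap.trace_mul_comm k (P _), mul_assoc]
  rw [← map_sum, ← Finset.mul_sum, h₂, mul_smul_comm, mul_one, map_smul]
  rfl

lemma exists_traceForm_ne_zero : ∃ f : A →ₗ[k] k, traceForm f ≠ 0 := by
  by_contra! H
  let b := Module.finBasis k A
  have h₁ : ∑ j, LinearMap.mulLeft k (antipode k (b j)) ∘ₗ antipode k ∘ₗ antipode k ∘ₗ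
      rightSlice (b.coord j) = (Coalgebra.counit (R := k) (A := A)).smulRight (1 : A) := by
    ext y
    have h := sum_mul_antipode_antipode (ℛ k y)
    simp only [antipode_eq_sum_coord b ((ℛ k y).right _), Finset.sum_mul] at h
    rw [Finset.sum_comm] at h
    simpa [rightSlice_apply _ (ℛ k y), Finset.mul_sum, Algebra.algebraMap_eq_smul_one] using h
  have h₂ := congr(LinearMap.trace k A $h₁)
  simp only [map_sum, ← traceForm_apply, H] at h₂
  simp [LinearMap.trace_smulRight] at h₂

/-- A functional `φ` with `a₁ φ(a₂) = φ(a) 1`. -/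
def IsLeftInvariant (φ : A →ₗ[k] k) : Prop := ∀ a, rightSlice φ a = φ a • 1

/-- A functional `φ` with `φ(a₁) a₂ = φ(a) 1`. -/
def IsRightInvariant (φ : A →ₗ[k] k) : Prop := ∀ a, leftSlice φ a = φ a • 1

variable (k A) in
lemma exists_isLeftInvariant : ∃ φ : A →ₗ[k] k, IsLeftInvariant φ ∧ φ ≠ 0 := by
  obtain ⟨f, hf⟩ := exists_traceForm_ne_zero (k := k) (A := A)
  refine ⟨traceForm f, fun a => Module.eq_of_forall_dual_apply_eq k fun g => ?_, hf⟩
  rw [apply_rightSlice, traceForm_leftSlice, map_smul, smul_eq_mul, mul_comm]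

end FiniteDimensional
lemma rightSlice_mul {ι : Type*} (p : A →ₗ[k] k) {a : A} (r : Repr k a ι) (b : A) :
    rightSlice p (a * b) =
      ∑ i ∈ r.index, r.left i * rightSlice (p ∘ₗ LinearMap.mulLeft k (r.right i)) b := by
  have h : ∑ i ∈ r.index, r.left i * rightSlice (p ∘ₗ LinearMap.mulLeft k (r.right i)) b =
      ∑ i ∈ r.index, ∑ j ∈ (ℛ k b).index,
        p (r.right i * (ℛ k b).right j) • (r.left i * (ℛ k b).left j) := by
    simp [rightSlice_apply _ (ℛ k b), Finset.mul_sum]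
  rw [h]
  simp [rightSlice, Bialgebra.comul_mul, ← r.eq, ← (ℛ k b).eq, Finset.sum_mul_sum]

namespace IsLeftInvariant
variable {φ : A →ₗ[k] k}

/-- Strong left invariance: `b₁ φ(a b₂) = S(a₁) φ(a₂ b)`. -/
lemma rightSlice_comp_mulLeft (hφ : IsLeftInvariant φ) (a b : A) :
    rightSlice (φ ∘ₗ LinearMap.mulLeft k a) b =
      antipode k (rightSlice (φ ∘ₗ LinearMap.mulRight k b) a) := by
  let X : A →ₗ[k] A :=
    { toFun a := rightSlice (φ ∘ₗ LinearMap.mulLeft k a) b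
      map_add' x y := by
        simp [rightSlice_apply _ (ℛ k b), add_mul, add_smul, Finset.sum_add_distrib]
      map_smul' c x := by simp [rightSlice_apply _ (ℛ k b), Finset.smul_sum, mul_smul] }
  let Y : A →ₗ[k] A := (φ ∘ₗ LinearMap.mulRight k b).smulRight 1
  have h : toConv LinearMap.id * toConv X = toConv Y := by
    ext x
    rw [(ℛ k x).convMul_apply]
    have := rightSlice_mul φ (ℛ k x) b
    rw [hφ] at this
    simpa [X, Y] using this.symm
  have h' : toConv X = toConv (antipode k) * toConv Y := by
    rw [← h, ← mul_assoc, LinearMap.antipode_mul_id, one_mul]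
  have := congr($h' a)
  rw [(ℛ k a).convMul_apply] at this
  rw [rightSlice_apply _ (ℛ k a)]
  simpa [X, Y] using this

lemma apply_mul_leftSlice (hφ : IsLeftInvariant φ) (g : A →ₗ[k] k) (a b : A) :
    φ (a * leftSlice g b) = g (antipode k (rightSlice (φ ∘ₗ LinearMap.mulRight k b) a)) := by
  rw [← hφ.rightSlice_comp_mulLeft, apply_rightSlice]
  rfl

section FiniteDimensional
variable [FiniteDimensional k A]

lemma eq_zero_of_forall_apply_mul (hφ : IsLeftInvariant φ) (h0 : φ ≠ 0) {b : A}
    (hb : ∀ a, φ (a * b) = 0) : b = 0 := by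
  have hslice {b : A} (hb : ∀ a, φ (a * b) = 0) (g : A →ₗ[k] k) (a : A) :
      φ (a * leftSlice g b) = 0 := by
    have : φ ∘ₗ LinearMap.mulRight k b = 0 := by ext a; exact hb a
    simp [hφ.apply_mul_leftSlice, this, rightSlice]
  have hcounit {b : A} (hb : ∀ a, φ (a * b) = 0) : Coalgebra.counit (R := k) b = 0 := by
    obtain ⟨x, hx⟩ : ∃ x, φ x ≠ 0 := by
      by_contra! H
      exact h0 (LinearMap.ext H)
    let e := Module.finBasis k A
    have h := sum_antipode_mul_eq_algebraMap_counit (ℛ k b)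
    simp only [antipode_eq_sum_coord e ((ℛ k b).left _), Finset.sum_mul] at h
    rw [Finset.sum_comm] at h
    have h₁ : ∑ j, antipode k (e j) * leftSlice (e.coord j) b =
        algebraMap k A (Coalgebra.counit b) := by
      simpa [leftSlice_apply _ (ℛ k b), Finset.mul_sum] using h
    have h₂ := congr(φ (x * $h₁))
    simp only [Finset.mul_sum, ← mul_assoc, map_sum, hslice hb, Finset.sum_const_zero,
      Algebra.algebraMap_eq_smul_one, mul_smul_comm, mul_one, map_smul, smul_eq_mul] at h₂
    exact (mul_eq_zero.1 h₂.symm).resolve_right hx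
  refine Module.eq_of_forall_dual_apply_eq k fun g => ?_
  rw [map_zero, ← counit_leftSlice, hcounit (hslice hb g)]

lemma bijective_compr₂ (hφ : IsLeftInvariant φ) (h0 : φ ≠ 0) :
    Function.Bijective ((LinearMap.mul k A).compr₂ φ) := by
  have hinj : Function.Injective ((LinearMap.mul k A).compr₂ φ).flip := by
    refine (injective_iff_map_eq_zero _).2 fun b hb => ?_
    exact hφ.eq_zero_of_forall_apply_mul h0 fun a => congr($hb a)
  rw [← LinearMap.flip_bijective_iff₁]
  exact ⟨hinj, (LinearMap.injective_iff_surjective_of_finrank_eq_finrank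
    (Subspace.dual_finrank_eq (K := k) (V := A)).symm).1 hinj⟩

lemma exists_eq_smul (hφ : IsLeftInvariant φ) (h0 : φ ≠ 0) {ψ : A →ₗ[k] k}
    (hψ : IsLeftInvariant ψ) : ∃ c : k, ψ = c • φ := by
  obtain ⟨c, hc⟩ := (LinearMap.flip_bijective_iff₁.2 (hφ.bijective_compr₂ h0)).2 ψ
  have hc' : φ ∘ₗ LinearMap.mulRight k c = ψ := hc
  have h (g : A →ₗ[k] k) : leftSlice g c = g 1 • c := by
    refine sub_eq_zero.1 <| hφ.eq_zero_of_forall_apply_mul h0 fun a => ?_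
    have h₁ : φ (a * c) = ψ a := congr($hc a)
    rw [mul_sub, map_sub, hφ.apply_mul_leftSlice, hc', hψ]
    simp [h₁, mul_comm]
  refine ⟨Coalgebra.counit (R := k) c, ?_⟩
  have h' : c = Coalgebra.counit (R := k) c • 1 := Module.eq_of_forall_dual_apply_eq k fun g => by
    rw [← counit_leftSlice, h, map_smul, map_smul, smul_eq_mul, smul_eq_mul, mul_comm]
  rw [← hc', h']
  ext a
  simp

lemma bijective_antipode (hφ : IsLeftInvariant φ) (h0 : φ ≠ 0) :
    Function.Bijective (antipode k (A := A)) := by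
  have hsurj : Function.Surjective (antipode k (A := A)) := fun b => by
    obtain ⟨a, ha⟩ := (hφ.bijective_compr₂ h0).2 (Coalgebra.counit (R := k))
    have ha' : φ ∘ₗ LinearMap.mulLeft k a = Coalgebra.counit (R := k) := ha
    refine ⟨_, (hφ.rightSlice_comp_mulLeft a b).symm.trans ?_⟩
    rw [ha', rightSlice_counit, LinearMap.id_apply]
  exact ⟨LinearMap.injective_iff_surjective.2 hsurj, hsurj⟩

end FiniteDimensional

lemma comp_antipode (hφ : IsLeftInvariant φ) (hS : Function.Injective (antipode k (A := A))) :
    IsRightInvariant (φ ∘ₗ antipode k) := fun a => hS <| by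
  rw [← rightSlice_antipode, hφ, map_smul, antipode_one, LinearMap.comp_apply]

end IsLeftInvariant

lemma IsRightInvariant.comp_antipode {φ : A →ₗ[k] k} (hφ : IsRightInvariant φ)
    (hS : Function.Injective (antipode k (A := A))) :
    IsLeftInvariant (φ ∘ₗ antipode k) := fun a => hS <| by
  rw [← leftSlice_antipode, hφ, map_smul, antipode_one, LinearMap.comp_apply]

variable (k A) in
lemma exists_isRightInvariant [FiniteDimensional k A] :
    ∃ φ : A →ₗ[k] k, IsRightInvariant φ ∧ φ ≠ 0 ∧
      ∀ ψ : A →ₗ[k] k, IsRightInvariant ψ → ∃ c : k, ψ = c • φ := by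
  obtain ⟨φ, hφ, h0⟩ := exists_isLeftInvariant k A
  have hS := hφ.bijective_antipode h0
  have hcancel {p q : A →ₗ[k] k} (h : p ∘ₗ antipode k = q ∘ₗ antipode k) : p = q :=
    (LinearMap.cancel_right hS.2).1 h
  have hne : φ ∘ₗ antipode k ≠ 0 := fun h => h0 (hcancel (h.trans (LinearMap.zero_comp _).symm))
  have hφ' := hφ.comp_antipode hS.1
  refine ⟨_, hφ', hne, fun ψ hψ => ?_⟩
  obtain ⟨c, hc⟩ := (hφ'.comp_antipode hS.1).exists_eq_smul
    (fun h => hne (hcancel (h.trans (LinearMap.zero_comp _).symm))) (hψ.comp_antipode hS.1)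
  exact ⟨c, hcancel (hc.trans (LinearMap.smul_comp ..).symm)⟩

end HopfAlgebra

namespace HopfGCoalgebra

lemma eq_smul_of_forall_smul_one {k : Type*} [Field k] {π : Type*} {H : π → Type*}
    [∀ α, Ring (H α)] [∀ α, Algebra k (H α)] {lam lam' : ∀ α : π, H α →ₗ[k] k} {c : k}
    (h : ∀ α x, lam' α x • (1 : H α) = (c * lam α x) • 1) : lam' = c • lam := by
  funext α
  ext x
  by_cases hα : (1 : H α) = 0
  · obtain rfl : x = 0 := eq_of_zero_eq_one hα.symm _ _
    simp
  · exact smul_left_injective k hα (h α x)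

variable {k : Type*} [Field k] {π : Type*} [Group π] {H : π → Type*}
  [∀ α, Ring (H α)] [∀ α, Algebra k (H α)]

variable [HopfGCoalgebra k H]

variable (k H) in
/-- The comultiplication `H γ → H α ⊗ H β` attached to a factorization `γ = αβ`. -/
def comulCast {α β γ : π} (h : γ = α * β) : H γ →ₐ[k] H α ⊗[k] H β :=
  (Δ α β).comp (gcast k H h).toAlgHom

variable (k H) in
/-- The antipode `H α → H β` attached to an equality `β = α⁻¹`. -/
def antipodeCast {α β : π} (h : β = α⁻¹) : H α →ₗ[k] H β :=
  (gcast k H h.symm).toLinearMap ∘ₗ S α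

lemma comulCast_coassoc {α β γ αβ βγ δ : π} (h₁ : αβ = α * β) (h₂ : δ = αβ * γ)
    (h₃ : βγ = β * γ) (h₄ : δ = α * βγ) (x : H δ) :
    TensorProduct.assoc k (H α) (H β) (H γ)
        (TensorProduct.map (comulCast k H h₁).toLinearMap LinearMap.id (comulCast k H h₂ x)) =
      TensorProduct.map LinearMap.id (comulCast k H h₃).toLinearMap (comulCast k H h₄ x) := by
  subst h₁ h₃ h₂
  exact congr($(coassoc (k := k) (H := H) α β γ) x)

lemma comulCast_counit_right {α : π} (h : α = α * 1) (x : H α) :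
    TensorProduct.rid k (H α) (TensorProduct.map LinearMap.id
      (ε (k := k) (H := H)).toLinearMap (comulCast k H h x)) = x :=
  congr($(counit_right (k := k) (H := H) α) x)

lemma comulCast_counit_left {α : π} (h : α = 1 * α) (x : H α) :
    TensorProduct.lid k (H α) (TensorProduct.map
      (ε (k := k) (H := H)).toLinearMap LinearMap.id (comulCast k H h x)) = x :=
  congr($(counit_left (k := k) (H := H) α) x)

lemma mul_antipodeCast_left {α β : π} (h : 1 = α * β) (hβ : β = α⁻¹) (x : H 1) :
    LinearMap.mul' k (H β) (TensorProduct.map (antipodeCast k H hβ) LinearMap.id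
      (comulCast k H h x)) = algebraMap k (H β) (ε x) := by
  obtain rfl : α = β⁻¹ := by rw [hβ, inv_inv]
  have key (e : H (β⁻¹ * β)) := congr($(antipode_left (k := k) (H := H) β) e)
  refine (key (gcast k H h x)).trans ?_
  have (γ : π) (h₁ : 1 = γ) (h₂ : γ = 1) (x : H 1) : gcast k H h₂ (gcast k H h₁ x) = x := by
    subst h₁; rfl
  exact congr(algebraMap k (H β) (ε $(this _ h (inv_mul_cancel β) x)))

lemma mul_antipodeCast_right {α β : π} (h : 1 = α * β) (hα : α = β⁻¹) (x : H 1) :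
    LinearMap.mul' k (H α) (TensorProduct.map LinearMap.id (antipodeCast k H hα)
      (comulCast k H h x)) = algebraMap k (H α) (ε x) := by
  obtain rfl : β = α⁻¹ := by rw [hα, inv_inv]
  have key (e : H (α * α⁻¹)) := congr($(antipode_right (k := k) (H := H) α) e)
  refine (key (gcast k H h x)).trans ?_
  have (γ : π) (h₁ : 1 = γ) (h₂ : γ = 1) (x : H 1) : gcast k H h₂ (gcast k H h₁ x) = x := by
    subst h₁; rfl
  exact congr(algebraMap k (H α) (ε $(this _ h (mul_inv_cancel α) x)))

variable (k H) in
/-- The neutral component of a Hopf `π`-coalgebra is a Hopf algebra. -/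
abbrev hopfAlgebraOne : HopfAlgebra k (H 1) :=
  letI : Bialgebra k (H 1) := Bialgebra.ofAlgHom (comulCast k H (mul_one 1).symm) ε
    (AlgHom.ext fun x => comulCast_coassoc (mul_one 1).symm (mul_one 1).symm (mul_one 1).symm
      (mul_one 1).symm x)
    (AlgHom.ext fun x => (TensorProduct.lid k (H 1)).injective <| by
      refine (comulCast_counit_left (mul_one 1).symm x).trans ?_
      simp)
    (AlgHom.ext fun x => (TensorProduct.rid k (H 1)).injective <| by
      refine (comulCast_counit_right (mul_one 1).symm x).trans ?_
      simp)
  { antipode := antipodeCast k H inv_one.symm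
    mul_antipode_rTensor_comul := LinearMap.ext fun x =>
      mul_antipodeCast_left (mul_one 1).symm inv_one.symm x
    mul_antipode_lTensor_comul := LinearMap.ext fun x =>
      mul_antipodeCast_right (mul_one 1).symm inv_one.symm x }

variable (k H) in
lemma exists_left_invariant_one [FiniteDimensional k (H 1)] :
    ∃ φ : H 1 →ₗ[k] k, φ ≠ 0 ∧
      (∀ x, TensorProduct.rid k (H 1) (TensorProduct.map LinearMap.id φ
        (comulCast k H (mul_one 1).symm x)) = φ x • 1) ∧
      ∀ ψ : H 1 →ₗ[k] k, (∀ x, TensorProduct.rid k (H 1) (TensorProduct.map LinearMap.id ψ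
        (comulCast k H (mul_one 1).symm x)) = ψ x • 1) → ∃ c : k, ψ = c • φ := by
  let := hopfAlgebraOne k H
  obtain ⟨φ, hφ, h0⟩ := HopfAlgebra.exists_isLeftInvariant k (H 1)
  exact ⟨φ, h0, hφ, fun ψ hψ => hφ.exists_eq_smul h0 hψ⟩

variable (k H) in
lemma exists_right_invariant_one [FiniteDimensional k (H 1)] :
    ∃ φ : H 1 →ₗ[k] k, φ ≠ 0 ∧
      (∀ x, TensorProduct.lid k (H 1) (TensorProduct.map φ LinearMap.id
        (comulCast k H (one_mul 1).symm x)) = φ x • 1) ∧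
      ∀ ψ : H 1 →ₗ[k] k, (∀ x, TensorProduct.lid k (H 1) (TensorProduct.map ψ LinearMap.id
        (comulCast k H (one_mul 1).symm x)) = ψ x • 1) → ∃ c : k, ψ = c • φ := by
  let := hopfAlgebraOne k H
  obtain ⟨φ, hφ, h0, huniq⟩ := HopfAlgebra.exists_isRightInvariant k (H 1)
  exact ⟨φ, h0, hφ, huniq⟩

lemma one_eq_zero_of_inv (k : Type*) [Field k] {π : Type*} [Group π] (H : π → Type*)
    [∀ α, Ring (H α)] [∀ α, Algebra k (H α)] [HopfGCoalgebra k H]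
    {α β : π} (h : α = β⁻¹) (hβ : (1 : H β) = 0) : (1 : H α) = 0 := by
  have := mul_antipodeCast_right (k := k) (H := H) (by rw [h, inv_mul_cancel]) h 1
  simpa [Algebra.TensorProduct.one_def, hβ] using this.symm

lemma one_ne_zero_one (k : Type*) [Field k] {π : Type*} [Group π] (H : π → Type*)
    [∀ α, Ring (H α)] [∀ α, Algebra k (H α)] [HopfGCoalgebra k H] :
    (1 : H 1) ≠ 0 := fun h => by
  simpa using congr(ε (k := k) (H := H) $h)

lemma one_eq_zero_or_of_mul (k : Type*) [Field k] {π : Type*} [Group π] (H : π → Type*)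
    [∀ α, Ring (H α)] [∀ α, Algebra k (H α)] [HopfGCoalgebra k H]
    {α β γ : π} (h : γ = α * β) (hγ : (1 : H γ) = 0) :
    (1 : H α) = 0 ∨ (1 : H β) = 0 := by
  by_contra! hne
  have := map_one (comulCast k H h)
  rw [hγ, map_zero, Algebra.TensorProduct.one_def, ← TensorProduct.tmul_zero] at this
  exact hne.2 (TensorProduct.tmul_left_cancel (k := k) hne.1 this).symm

/-- The operator `x ↦ x₁ φ(x₂)` on `H α`, for a functional `φ` on `H 1`. -/
def hitLeft (φ : H 1 →ₗ[k] k) (α : π) : H α →ₗ[k] H α :=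
  (TensorProduct.rid k (H α)).toLinearMap ∘ₗ TensorProduct.map LinearMap.id φ ∘ₗ
    (comulCast k H (mul_one α).symm).toLinearMap

lemma map_hitLeft_comulCast (φ : H 1 →ₗ[k] k) {α β γ : π} (h : γ = α * β) (x : H γ) :
    TensorProduct.map LinearMap.id (hitLeft φ β) (comulCast k H h x) =
      comulCast k H h (hitLeft φ γ x) := by
  have key := congr(TensorProduct.map (LinearMap.id : H α →ₗ[k] H α)
    ((TensorProduct.rid k (H β)).toLinearMap ∘ₗ TensorProduct.map LinearMap.id φ)
    $(comulCast_coassoc h (mul_one γ).symm (mul_one β).symm h x))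
  rw [TensorProduct.map_map] at key
  refine Eq.trans ?_ (key.symm.trans ?_)
  · rfl
  have (t : H γ ⊗[k] H 1) : TensorProduct.map (LinearMap.id : H α →ₗ[k] H α)
      ((TensorProduct.rid k (H β)).toLinearMap ∘ₗ TensorProduct.map LinearMap.id φ)
      (TensorProduct.assoc k (H α) (H β) (H 1)
        (TensorProduct.map (comulCast k H h).toLinearMap LinearMap.id t)) =
      comulCast k H h (TensorProduct.rid k (H γ) (TensorProduct.map LinearMap.id φ t)) := by
    induction t with
    | zero => simp
    | add x y hx hy => simp only [map_add, hx, hy]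
    | tmul x y =>
      simp only [TensorProduct.map_tmul, TensorProduct.rid_tmul, map_smul, LinearMap.id_apply,
        AlgHom.toLinearMap_apply]
      induction comulCast k H h x with
      | zero => simp
      | add x y hx hy => simp only [TensorProduct.add_tmul, map_add, smul_add, hx, hy]
      | tmul x y => simp
  exact this _

lemma one_tmul_hitLeft {φ : H 1 →ₗ[k] k} (hφ : ∀ x, hitLeft φ 1 x = φ x • 1) {α β : π}
    (hβ : β = α⁻¹) (x : H α) :
    (1 : H β) ⊗ₜ[k] hitLeft φ α x = antipodeCast k H hβ (hitLeft φ α x) ⊗ₜ[k] (1 : H α) := by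
  have hαβ : 1 = α * β := by rw [hβ, mul_inv_cancel]
  have hβα : 1 = β * α := by rw [hβ, inv_mul_cancel]
  let M : H α ⊗[k] (H β ⊗[k] H α) →ₗ[k] H β ⊗[k] H α :=
    TensorProduct.map
      (LinearMap.mul' k (H β) ∘ₗ TensorProduct.map (antipodeCast k H hβ) LinearMap.id)
      (hitLeft φ α) ∘ₗ (TensorProduct.assoc k (H α) (H β) (H α)).symm.toLinearMap
  have key := congr(M $(comulCast_coassoc hαβ (one_mul α).symm hβα (mul_one α).symm x))
  have hl (t : H 1 ⊗[k] H α) : M (TensorProduct.assoc k (H α) (H β) (H α)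
      (TensorProduct.map (comulCast k H hαβ).toLinearMap LinearMap.id t)) =
      1 ⊗ₜ[k] hitLeft φ α (TensorProduct.lid k (H α)
        (TensorProduct.map (ε (k := k) (H := H)).toLinearMap LinearMap.id t)) := by
    induction t with
    | zero => simp
    | add x y hx hy => simp only [map_add, hx, hy, TensorProduct.tmul_add]
    | tmul y z =>
      simp [M, mul_antipodeCast_left, Algebra.algebraMap_eq_smul_one, TensorProduct.smul_tmul]
  have hM (y : H α) (t : H β ⊗[k] H α) : M (y ⊗ₜ[k] t) =
      TensorProduct.map (LinearMap.mulLeft k (antipodeCast k H hβ y)) LinearMap.id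
        (TensorProduct.map LinearMap.id (hitLeft φ α) t) := by
    induction t with
    | zero => simp
    | add x z hx hz => simp only [map_add, hx, hz, TensorProduct.tmul_add]
    | tmul z w => simp [M]
  have hr (t : H α ⊗[k] H 1) :
      M (TensorProduct.map LinearMap.id (comulCast k H hβα).toLinearMap t) =
        antipodeCast k H hβ (TensorProduct.rid k (H α)
          (TensorProduct.map LinearMap.id φ t)) ⊗ₜ[k] (1 : H α) := by
    induction t with
    | zero => simp
    | add x z hx hz => simp only [map_add, hx, hz, TensorProduct.add_tmul]
    | tmul y z =>
      rw [TensorProduct.map_tmul, hM, AlgHom.toLinearMap_apply, map_hitLeft_comulCast, hφ]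
      simp [Algebra.TensorProduct.one_def, TensorProduct.smul_tmul']
  rw [hl, hr, comulCast_counit_left] at key
  exact key

lemma exists_hitLeft_eq_smul {φ : H 1 →ₗ[k] k} (hφ : ∀ x, hitLeft φ 1 x = φ x • 1) (α : π)
    (x : H α) : ∃ c : k, hitLeft φ α x = c • 1 := by
  by_cases hα : (1 : H α) = 0
  · exact ⟨0, eq_of_zero_eq_one hα.symm _ _⟩
  have hα' : (1 : H α⁻¹) ≠ 0 := fun h => hα (one_eq_zero_of_inv k H (inv_inv α).symm h)
  obtain ⟨f, hf⟩ := Module.exists_dual_eq_one k hα'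
  have := congr(TensorProduct.lid k (H α) (TensorProduct.map f LinearMap.id
    $(one_tmul_hitLeft hφ rfl x)))
  exact ⟨_, by simpa [hf] using this⟩

/-- The operator `x ↦ φ(x₁) x₂` on `H α`, for a functional `φ` on `H 1`. -/
def hitRight (φ : H 1 →ₗ[k] k) (α : π) : H α →ₗ[k] H α :=
  (TensorProduct.lid k (H α)).toLinearMap ∘ₗ TensorProduct.map φ LinearMap.id ∘ₗ
    (comulCast k H (one_mul α).symm).toLinearMap

lemma map_hitRight_comulCast (φ : H 1 →ₗ[k] k) {α β γ : π} (h : γ = α * β) (x : H γ) :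
    TensorProduct.map (hitRight φ α) LinearMap.id (comulCast k H h x) =
      comulCast k H h (hitRight φ γ x) := by
  have key := congr(TensorProduct.map
    ((TensorProduct.lid k (H α)).toLinearMap ∘ₗ TensorProduct.map φ LinearMap.id)
    (LinearMap.id : H β →ₗ[k] H β) ((TensorProduct.assoc k (H 1) (H α) (H β)).symm
    $(comulCast_coassoc (one_mul α).symm h h (one_mul γ).symm x)))
  rw [LinearEquiv.symm_apply_apply, TensorProduct.map_map] at key
  refine Eq.trans ?_ (key.trans ?_)
  · rfl
  have (t : H 1 ⊗[k] H γ) : TensorProduct.map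
      ((TensorProduct.lid k (H α)).toLinearMap ∘ₗ TensorProduct.map φ LinearMap.id)
      (LinearMap.id : H β →ₗ[k] H β) ((TensorProduct.assoc k (H 1) (H α) (H β)).symm
        (TensorProduct.map LinearMap.id (comulCast k H h).toLinearMap t)) =
      comulCast k H h (TensorProduct.lid k (H γ) (TensorProduct.map φ LinearMap.id t)) := by
    induction t with
    | zero => simp
    | add x y hx hy => simp only [map_add, hx, hy]
    | tmul x y =>
      simp only [TensorProduct.map_tmul, TensorProduct.lid_tmul, map_smul, LinearMap.id_apply,
        AlgHom.toLinearMap_apply]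
      induction comulCast k H h y with
      | zero => simp
      | add x y hx hy => simp only [TensorProduct.tmul_add, map_add, smul_add, hx, hy]
      | tmul x y => simp [TensorProduct.smul_tmul']
  exact this _

lemma hitRight_tmul_one {φ : H 1 →ₗ[k] k} (hφ : ∀ x, hitRight φ 1 x = φ x • 1) {α β : π}
    (hβ : β = α⁻¹) (x : H α) :
    hitRight φ α x ⊗ₜ[k] (1 : H β) = (1 : H α) ⊗ₜ[k] antipodeCast k H hβ (hitRight φ α x) := by
  have hαβ : 1 = α * β := by rw [hβ, mul_inv_cancel]
  have hβα : 1 = β * α := by rw [hβ, inv_mul_cancel]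
  let M : (H α ⊗[k] H β) ⊗[k] H α →ₗ[k] H α ⊗[k] H β :=
    TensorProduct.map (hitRight φ α)
      (LinearMap.mul' k (H β) ∘ₗ TensorProduct.map LinearMap.id (antipodeCast k H hβ)) ∘ₗ
      (TensorProduct.assoc k (H α) (H β) (H α)).toLinearMap
  have key := congr(M ((TensorProduct.assoc k (H α) (H β) (H α)).symm
    $(comulCast_coassoc hαβ (one_mul α).symm hβα (mul_one α).symm x)))
  rw [LinearEquiv.symm_apply_apply] at key
  have hl (t : H α ⊗[k] H 1) : M ((TensorProduct.assoc k (H α) (H β) (H α)).symm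
      (TensorProduct.map LinearMap.id (comulCast k H hβα).toLinearMap t)) =
      hitRight φ α (TensorProduct.rid k (H α)
        (TensorProduct.map LinearMap.id (ε (k := k) (H := H)).toLinearMap t)) ⊗ₜ[k] 1 := by
    induction t with
    | zero => simp
    | add x y hx hy => simp only [map_add, hx, hy, TensorProduct.add_tmul]
    | tmul y z =>
      simp [M, mul_antipodeCast_right, Algebra.algebraMap_eq_smul_one, TensorProduct.smul_tmul]
  have hM (y : H α) (t : H α ⊗[k] H β) : M (t ⊗ₜ[k] y) =
      TensorProduct.map LinearMap.id (LinearMap.mulRight k (antipodeCast k H hβ y))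
        (TensorProduct.map (hitRight φ α) LinearMap.id t) := by
    induction t with
    | zero => simp
    | add x z hx hz => simp only [map_add, hx, hz, TensorProduct.add_tmul]
    | tmul z w => simp [M]
  have hr (t : H 1 ⊗[k] H α) :
      M (TensorProduct.map (comulCast k H hαβ).toLinearMap LinearMap.id t) =
        (1 : H α) ⊗ₜ[k] antipodeCast k H hβ (TensorProduct.lid k (H α)
          (TensorProduct.map φ LinearMap.id t)) := by
    induction t with
    | zero => simp
    | add x z hx hz => simp only [map_add, hx, hz, TensorProduct.tmul_add]
    | tmul y z =>
      rw [TensorProduct.map_tmul, hM, AlgHom.toLinearMap_apply, map_hitRight_comulCast, hφ]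
      simp [Algebra.TensorProduct.one_def]
  rw [hl, hr, comulCast_counit_right] at key
  exact key.symm

lemma exists_hitRight_eq_smul {φ : H 1 →ₗ[k] k} (hφ : ∀ x, hitRight φ 1 x = φ x • 1) (α : π)
    (x : H α) : ∃ c : k, hitRight φ α x = c • 1 := by
  by_cases hα : (1 : H α) = 0
  · exact ⟨0, eq_of_zero_eq_one hα.symm _ _⟩
  have hα' : (1 : H α⁻¹) ≠ 0 := fun h => hα (one_eq_zero_of_inv k H (inv_inv α).symm h)
  obtain ⟨f, hf⟩ := Module.exists_dual_eq_one k hα'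
  have := congr(TensorProduct.rid k (H α) (TensorProduct.map LinearMap.id f
    $(hitRight_tmul_one hφ rfl x)))
  exact ⟨_, by simpa [hf] using this⟩

lemma IsLeftIntegral.rid_map_comulCast {lam : ∀ α : π, H α →ₗ[k] k} (h : IsLeftIntegral k H lam)
    {α β γ : π} (e : γ = α * β) (x : H γ) :
    TensorProduct.rid k (H α) (TensorProduct.map LinearMap.id (lam β) (comulCast k H e x)) =
      lam γ x • 1 := by
  subst e
  exact h α β x

lemma IsRightIntegral.lid_map_comulCast {lam : ∀ α : π, H α →ₗ[k] k}
    (h : IsRightIntegral k H lam) {α β γ : π} (e : γ = α * β) (x : H γ) :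
    TensorProduct.lid k (H β) (TensorProduct.map (lam α) LinearMap.id (comulCast k H e x)) =
      lam γ x • 1 := by
  subst e
  exact h α β x

lemma isLeftIntegral_of_hitLeft {φ : H 1 →ₗ[k] k} {lam : ∀ α : π, H α →ₗ[k] k}
    (hlam : ∀ α x, hitLeft φ α x = lam α x • 1) : IsLeftIntegral k H lam := fun α β x => by
  by_cases hα : (1 : H α) = 0
  · exact eq_of_zero_eq_one hα.symm _ _
  by_cases hβ : (1 : H β) = 0
  · have hαβ : (1 : H (α * β)) = 0 :=
      (one_eq_zero_or_of_mul k H (inv_mul_cancel_left α β).symm hβ).resolve_left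
        fun h => hα (one_eq_zero_of_inv k H (inv_inv α).symm h)
    obtain rfl : x = 0 := eq_of_zero_eq_one hαβ.symm _ _
    simp
  refine TensorProduct.tmul_right_cancel (k := k) hβ ?_
  have key := map_hitLeft_comulCast φ (rfl : α * β = α * β) x
  rw [hlam, map_smul, map_one, Algebra.TensorProduct.one_def] at key
  rw [← TensorProduct.smul_tmul', ← key]
  change _ = TensorProduct.map LinearMap.id (hitLeft φ β) (Δ α β x)
  induction Δ (k := k) (H := H) α β x with
  | zero => simp
  | add x y hx hy => simp only [map_add, TensorProduct.add_tmul, hx, hy]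
  | tmul x y => simp [hlam, TensorProduct.smul_tmul]

lemma isRightIntegral_of_hitRight {φ : H 1 →ₗ[k] k} {lam : ∀ α : π, H α →ₗ[k] k}
    (hlam : ∀ α x, hitRight φ α x = lam α x • 1) : IsRightIntegral k H lam := fun α β x => by
  by_cases hβ : (1 : H β) = 0
  · exact eq_of_zero_eq_one hβ.symm _ _
  by_cases hα : (1 : H α) = 0
  · have hαβ : (1 : H (α * β)) = 0 :=
      (one_eq_zero_or_of_mul k H (mul_inv_cancel_right α β).symm hα).resolve_right
        fun h => hβ (one_eq_zero_of_inv k H (inv_inv β).symm h)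
    obtain rfl : x = 0 := eq_of_zero_eq_one hαβ.symm _ _
    simp
  refine TensorProduct.tmul_left_cancel (k := k) hα ?_
  have key := map_hitRight_comulCast φ (rfl : α * β = α * β) x
  rw [hlam, map_smul, map_one, Algebra.TensorProduct.one_def] at key
  rw [TensorProduct.tmul_smul, ← key]
  change _ = TensorProduct.map (hitRight φ α) LinearMap.id (Δ α β x)
  induction Δ (k := k) (H := H) α β x with
  | zero => simp
  | add x y hx hy => simp only [map_add, TensorProduct.tmul_add, hx, hy]
  | tmul x y => simp [hlam, TensorProduct.smul_tmul]

lemma ne_zero_of_smul_one {φ : H 1 →ₗ[k] k} (h0 : φ ≠ 0) {lam : ∀ α : π, H α →ₗ[k] k}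
    (h : ∀ x, φ x • (1 : H 1) = lam 1 x • 1) : lam ≠ 0 := by
  rintro rfl
  refine h0 (LinearMap.ext fun x => ?_)
  simpa [one_ne_zero_one k H] using h x

variable (k H) in
lemma exists_left_integral [FiniteDimensional k (H 1)] :
    ∃ lam : ∀ α : π, H α →ₗ[k] k, IsLeftIntegral k H lam ∧ lam ≠ 0 ∧
      ∀ lam' : ∀ α : π, H α →ₗ[k] k, IsLeftIntegral k H lam' → ∃ c : k, lam' = c • lam := by
  obtain ⟨φ, h0, hφ, huniq⟩ := exists_left_invariant_one k H
  choose f hf using fun α => Module.exists_dual_smul_eq k (1 : H α)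
  have hlam α x : hitLeft φ α x = (f α ∘ₗ hitLeft φ α) x • 1 := by
    obtain ⟨c, hc⟩ := exists_hitLeft_eq_smul hφ α x
    rw [LinearMap.comp_apply, hc, hf]
  refine ⟨_, isLeftIntegral_of_hitLeft hlam,
    ne_zero_of_smul_one h0 fun x => (hφ x).symm.trans (hlam 1 x), fun lam' h' => ?_⟩
  obtain ⟨c, hc⟩ := huniq (lam' 1) fun x => h'.rid_map_comulCast _ x
  refine ⟨c, eq_smul_of_forall_smul_one fun α x => ?_⟩
  rw [← h'.rid_map_comulCast (mul_one α).symm, hc, mul_smul, ← hlam, TensorProduct.map_smul_right,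
    LinearMap.smul_apply, map_smul]
  rfl

variable (k H) in
lemma exists_right_integral [FiniteDimensional k (H 1)] :
    ∃ lam : ∀ α : π, H α →ₗ[k] k, IsRightIntegral k H lam ∧ lam ≠ 0 ∧
      ∀ lam' : ∀ α : π, H α →ₗ[k] k, IsRightIntegral k H lam' → ∃ c : k, lam' = c • lam := by
  obtain ⟨φ, h0, hφ, huniq⟩ := exists_right_invariant_one k H
  choose f hf using fun α => Module.exists_dual_smul_eq k (1 : H α)
  have hlam α x : hitRight φ α x = (f α ∘ₗ hitRight φ α) x • 1 := by
    obtain ⟨c, hc⟩ := exists_hitRight_eq_smul hφ α x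
    rw [LinearMap.comp_apply, hc, hf]
  refine ⟨_, isRightIntegral_of_hitRight hlam,
    ne_zero_of_smul_one h0 fun x => (hφ x).symm.trans (hlam 1 x), fun lam' h' => ?_⟩
  obtain ⟨c, hc⟩ := huniq (lam' 1) fun x => h'.lid_map_comulCast _ x
  refine ⟨c, eq_smul_of_forall_smul_one fun α x => ?_⟩
  rw [← h'.lid_map_comulCast (one_mul α).symm, hc, mul_smul, ← hlam, TensorProduct.map_smul_left,
    LinearMap.smul_apply, map_smul]
  rfl

end HopfGCoalgebra

/-- Theorem 3.3: for a finite dimensional Hopf `π`-coalgebra, the space of left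
(resp. right) `π`-integrals is one-dimensional. -/
theorem integrals_one_dimensional (k : Type*) [Field k] {π : Type*} [Group π]
    (H : π → Type*) [∀ α, Ring (H α)] [∀ α, Algebra k (H α)] [HopfGCoalgebra k H]
    [∀ α, FiniteDimensional k (H α)] :
    (∃ lam : ∀ α : π, H α →ₗ[k] k, IsLeftIntegral k H lam ∧ lam ≠ 0 ∧
        ∀ lam' : ∀ α : π, H α →ₗ[k] k, IsLeftIntegral k H lam' →
          ∃ c : k, lam' = c • lam) ∧
    (∃ lam : ∀ α : π, H α →ₗ[k] k, IsRightIntegral k H lam ∧ lam ≠ 0 ∧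
        ∀ lam' : ∀ α : π, H α →ₗ[k] k, IsRightIntegral k H lam' →
          ∃ c : k, lam' = c • lam) := by
  exact ⟨exists_left_integral k H, exists_right_integral k H⟩
end
end
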